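/- arXiv:1504.01721 — 2 statements merged into one kernel-verified Lean document; each statement's English description precedes it below -/
import Mathlib

section
/- There exist a strongly connected digraph D and a strong spanning subdigraph H of D such that src*(D) > src*(H). -/
open scoped Classical

namespace RainbowDigraph

variable {V : Type}

/-- `p` is a directed path (walk) from `x` to `y` in the digraph `D`. -/
def IsPathFrom (D : V → V → Prop) (x y : V) (p : List V) : Prop :=
  List.Chain' D p ∧ p.head? = some x ∧ p.getLast? = some y

/-- The arcs of `p` receive pairwise distinct colors under the arc-coloring `c`. -/
def RainbowPath {k : ℕ} (c : V → V → Fin k) (p : List V) : Prop :=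
  ((p.zip p.tail).map (fun e => c e.1 e.2)).Nodup

/-- Directed distance: the minimum number of arcs of a directed `x y`-path. -/
noncomputable def dist (D : V → V → Prop) (x y : V) : ℕ :=
  sInf {m | ∃ p, IsPathFrom D x y p ∧ p.length = m + 1}

/-- Directed diameter: the maximum distance over ordered pairs of vertices. -/
noncomputable def diam (D : V → V → Prop) : ℕ :=
  sSup {d | ∃ x y, d = dist D x y}

/-- Strong connectivity of a digraph. -/
def Connected (D : V → V → Prop) : Prop :=
  ∀ x y : V, ∃ p, IsPathFrom D x y p

/-- `c` is a rainbow connected arc-coloring of `D`. -/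
def IsRainbowConnected (D : V → V → Prop) {k : ℕ} (c : V → V → Fin k) : Prop :=
  ∀ x y : V, x ≠ y → ∃ p, IsPathFrom D x y p ∧ RainbowPath c p

/-- `c` is a strong rainbow connected arc-coloring of `D`: every ordered pair of
distinct vertices is joined by a rainbow geodesic. -/
def IsStrongRainbowConnected (D : V → V → Prop) {k : ℕ} (c : V → V → Fin k) : Prop :=
  ∀ x y : V, x ≠ y →
    ∃ p, IsPathFrom D x y p ∧ RainbowPath c p ∧ p.length = dist D x y + 1

/-- The rainbow connection number `rc*(D)`. -/
noncomputable def rcStar (D : V → V → Prop) : ℕ :=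
  sInf {k | ∃ c : V → V → Fin k, IsRainbowConnected D c}

/-- The strong rainbow connection number `src*(D)`. -/
noncomputable def srcStar (D : V → V → Prop) : ℕ :=
  sInf {k | ∃ c : V → V → Fin k, IsStrongRainbowConnected D c}

/-- The biorientation of a graph `G`: each edge `uv` is replaced by arcs `uv` and `vu`. -/
def bior (G : SimpleGraph V) : V → V → Prop := fun x y => G.Adj x y

/-- The (undirected) rainbow connection number `rc(G)`: minimum over symmetric
(edge-)colorings that are rainbow connected. -/
noncomputable def rc (G : SimpleGraph V) : ℕ :=
  sInf {k | ∃ c : V → V → Fin k, (∀ x y, c x y = c y x) ∧ IsRainbowConnected G.Adj c}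

/-- The (undirected) strong rainbow connection number `src(G)`. -/
noncomputable def src (G : SimpleGraph V) : ℕ :=
  sInf {k | ∃ c : V → V → Fin k, (∀ x y, c x y = c y x) ∧ IsStrongRainbowConnected G.Adj c}

/-- The circulant digraph `C_n(S)` on `ZMod n`: arc `i → j` iff `j - i ≡ s (mod n)`
for some `s ∈ S`. -/
def circulant (n : ℕ) (S : Set ℕ) : ZMod n → ZMod n → Prop :=
  fun i j => ∃ s ∈ S, j = i + (s : ZMod n)

/-- The biorientation of the cycle `C_n`, on vertices `ZMod n`. -/
def cycleBior (n : ℕ) : ZMod n → ZMod n → Prop :=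
  fun i j => j = i + 1 ∨ i = j + 1

/-- The biorientation of the path `P_n`, on vertices `Fin n`. -/
def pathBior (n : ℕ) : Fin n → Fin n → Prop :=
  fun i j => (j : ℕ) = (i : ℕ) + 1 ∨ (i : ℕ) = (j : ℕ) + 1

/-- The biorientation of the star `K_{1,n}`, with center `0`. -/
def starBior (n : ℕ) : Fin (n + 1) → Fin (n + 1) → Prop :=
  fun x y => x ≠ y ∧ (x = 0 ∨ y = 0)

/-- The arcs of `D`; the number `10 * x + y` encodes the arc from `x` to `y`. -/
def arcsD : List ℕ := [1, 2, 3, 10, 12, 24, 25, 31, 36, 43, 45, 50, 61, 64]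

/-- The arcs of `H`: all arcs of `D` except the one from `6` to `4`. -/
def arcsH : List ℕ := [1, 2, 3, 10, 12, 24, 25, 31, 36, 43, 45, 50, 61]

def exD (x y : Fin 7) : Prop := arcsD.contains (10 * x.val + y.val) = true

def exH (x y : Fin 7) : Prop := arcsH.contains (10 * x.val + y.val) = true

instance (x y : Fin 7) : Decidable (exD x y) := inferInstanceAs (Decidable (_ = true))

instance (x y : Fin 7) : Decidable (exH x y) := inferInstanceAs (Decidable (_ = true))

/-- A strong rainbow coloring of `H`. -/
def colH (x y : Fin 7) : Fin 3 :=
  if 10 * x.val + y.val ∈ [1, 2, 31, 36, 61] then 0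
  else if 10 * x.val + y.val ∈ [3, 24, 25, 45] then 1 else 2

/-- Rainbow geodesics of `H`. -/
def geoTable : List (List (List (Fin 7))) :=
    [[[0], [0, 1], [0, 2], [0, 3], [0, 2, 4], [0, 2, 5], [0, 3, 6]],
    [[1, 0], [1], [1, 2], [1, 0, 3], [1, 2, 4], [1, 2, 5], [1, 0, 3, 6]],
    [[2, 5, 0], [2, 4, 3, 1], [2], [2, 4, 3], [2, 4], [2, 5], [2, 4, 3, 6]],
    [[3, 1, 0], [3, 1], [3, 1, 2], [3], [3, 1, 2, 4], [3, 1, 2, 5], [3, 6]],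
    [[4, 5, 0], [4, 3, 1], [4, 5, 0, 2], [4, 3], [4], [4, 5], [4, 3, 6]],
    [[5, 0], [5, 0, 1], [5, 0, 2], [5, 0, 3], [5, 0, 2, 4], [5], [5, 0, 3, 6]],
    [[6, 1, 0], [6, 1], [6, 1, 2], [6, 1, 0, 3], [6, 1, 2, 4], [6, 1, 2, 5], [6]]]

def geo (x y : Fin 7) : List (Fin 7) := (geoTable.getD x.val []).getD y.val []

lemma geo_chain : ∀ x y : Fin 7, List.IsChain exH (geo x y) := by decide

lemma geo_head : ∀ x y : Fin 7, (geo x y).head? = some x := by decide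

lemma geo_last : ∀ x y : Fin 7, (geo x y).getLast? = some y := by decide

lemma geo_rainbow : ∀ x y : Fin 7,
    (((geo x y).zip (geo x y).tail).map (fun e => colH e.1 e.2)).Nodup := by decide

lemma geo_potential : ∀ x z y : Fin 7, exH x z →
    (geo x y).length ≤ (geo z y).length + 1 := by decide

lemma geo_self : ∀ y : Fin 7, (geo y y).length = 1 := by decide

section Table

variable {E : Fin 7 → Fin 7 → Prop} {g : Fin 7 → Fin 7 → List (Fin 7)}

lemma table_min (hpot : ∀ x z y : Fin 7, E x z → (g x y).length ≤ (g z y).length + 1)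
    (hself : ∀ y : Fin 7, (g y y).length = 1) (p : List (Fin 7)) :
    ∀ x y : Fin 7, IsPathFrom E x y p → (g x y).length ≤ p.length := by
  induction p with
  | nil => intro x y h; simp [IsPathFrom] at h
  | cons a t ih =>
    intro x y h
    obtain ⟨h1, h2, h3⟩ := h
    simp only [List.head?_cons, Option.some.injEq] at h2
    subst h2
    cases t with
    | nil =>
      simp only [List.getLast?_singleton, Option.some.injEq] at h3
      subst h3
      rw [hself]; simp
    | cons b t =>
      have h4 : E a b ∧ List.IsChain E (b :: t) := List.isChain_cons_cons.1 h1
      have h5 := ih b y ⟨h4.2, rfl, by simpa using h3⟩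
      have h6 := hpot a b y h4.1
      simp only [List.length_cons] at h5 ⊢
      omega

lemma table_length (hpath : ∀ x y, IsPathFrom E x y (g x y))
    (hpot : ∀ x z y : Fin 7, E x z → (g x y).length ≤ (g z y).length + 1)
    (hself : ∀ y : Fin 7, (g y y).length = 1) (x y : Fin 7) :
    (g x y).length = dist E x y + 1 := by
  have hpos : (g x y).length ≠ 0 := by
    intro h
    have := (hpath x y).2.1
    rw [List.length_eq_zero_iff.1 h] at this
    simp at this
  have hmem : (g x y).length - 1 ∈ {m | ∃ p, IsPathFrom E x y p ∧ p.length = m + 1} :=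
    ⟨g x y, hpath x y, by omega⟩
  have h1 : dist E x y ≤ (g x y).length - 1 := Nat.sInf_le hmem
  obtain ⟨p, hp, hl⟩ : dist E x y ∈ {m | ∃ p, IsPathFrom E x y p ∧ p.length = m + 1} :=
    Nat.sInf_mem ⟨_, hmem⟩
  have := table_min hpot hself p x y hp
  omega

end Table

lemma geo_path (x y : Fin 7) : IsPathFrom exH x y (geo x y) :=
  ⟨geo_chain x y, geo_head x y, geo_last x y⟩

lemma src_exH : srcStar exH ≤ 3 :=
  Nat.sInf_le ⟨colH, fun x y _ => ⟨geo x y, geo_path x y, geo_rainbow x y,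
    table_length geo_path geo_potential geo_self x y⟩⟩

lemma exH_le : ∀ x y : Fin 7, exH x y → exD x y := by decide

/-- A rainbow geodesic between vertices at distance two. -/
lemma two_step {k : ℕ} {c : Fin 7 → Fin 7 → Fin k} (hc : IsStrongRainbowConnected exD c)
    (x z y : Fin 7) (hxy : x ≠ y) (h0 : ¬ exD x y) (h1 : exD x z) (h2 : exD z y) :
    ∃ z, exD x z ∧ exD z y ∧ c x z ≠ c z y := by
  obtain ⟨p, ⟨p1, p2, p3⟩, p4, p5⟩ := hc x y hxy
  have hd : dist exD x y ≤ 2 := Nat.sInf_le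
    ⟨[x, z, y], ⟨by
      show List.IsChain exD _
      simp [h1, h2], rfl, rfl⟩, rfl⟩
  replace p1 : List.IsChain exD p := p1
  have hl : p.length ≤ 3 := by omega
  rcases p with _ | ⟨a, _ | ⟨b, _ | ⟨d, _ | ⟨e, t⟩⟩⟩⟩
  all_goals simp [RainbowPath] at p1 p2 p3 p4 hl
  all_goals subst p2
  all_goals try omega
  all_goals subst p3
  · exact absurd p1 h0
  · exact ⟨b, p1.1, p1.2, p4⟩

/-- A rainbow geodesic between vertices at distance three. -/
lemma three_step {k : ℕ} {c : Fin 7 → Fin 7 → Fin k} (hc : IsStrongRainbowConnected exD c)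
    (x u v y : Fin 7) (hxy : x ≠ y) (h0 : ¬ exD x y) (h00 : ∀ z, exD x z → ¬ exD z y)
    (h1 : exD x u) (h2 : exD u v) (h3 : exD v y) :
    ∃ z w, exD x z ∧ exD z w ∧ exD w y ∧ c x z ≠ c z w ∧ c x z ≠ c w y ∧ c z w ≠ c w y := by
  obtain ⟨p, ⟨p1, p2, p3⟩, p4, p5⟩ := hc x y hxy
  have hd : dist exD x y ≤ 3 := Nat.sInf_le
    ⟨[x, u, v, y], ⟨by
      show List.IsChain exD _
      simp [h1, h2, h3], rfl, rfl⟩, rfl⟩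
  replace p1 : List.IsChain exD p := p1
  have hl : p.length ≤ 4 := by omega
  rcases p with _ | ⟨a, _ | ⟨b, _ | ⟨d, _ | ⟨e, _ | ⟨f, t⟩⟩⟩⟩⟩
  all_goals simp [RainbowPath] at p1 p2 p3 p4 hl
  all_goals subst p2
  all_goals try omega
  all_goals subst p3
  · exact absurd p1 h0
  · exact absurd p1.2 (h00 _ p1.1)
  · exact ⟨b, d, p1.1, p1.2.1, p1.2.2, p4.1.1, p4.1.2, p4.2⟩

lemma two_uniq {k : ℕ} {c : Fin 7 → Fin 7 → Fin k} (hc : IsStrongRainbowConnected exD c)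
    (x z y : Fin 7) (h : x ≠ y ∧ ¬ exD x y ∧ exD x z ∧ exD z y ∧
      ∀ w, exD x w → exD w y → w = z) : c x z ≠ c z y := by
  obtain ⟨h1, h2, h3, h4, h5⟩ := h
  obtain ⟨w, w1, w2, w3⟩ := two_step hc x z y h1 h2 h3 h4
  rwa [h5 w w1 w2] at w3

/-- Either of two geodesics of length three is rainbow (they may coincide). -/
lemma three_or {k : ℕ} {c : Fin 7 → Fin 7 → Fin k} (hc : IsStrongRainbowConnected exD c)
    (x u v u' v' y : Fin 7) (h : x ≠ y ∧ ¬ exD x y ∧ (∀ z, exD x z → ¬ exD z y) ∧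
      exD x u ∧ exD u v ∧ exD v y ∧
      ∀ z w, exD x z → exD z w → exD w y → (z = u ∧ w = v) ∨ (z = u' ∧ w = v')) :
    (c x u ≠ c u v ∧ c x u ≠ c v y ∧ c u v ≠ c v y) ∨
    (c x u' ≠ c u' v' ∧ c x u' ≠ c v' y ∧ c u' v' ≠ c v' y) := by
  obtain ⟨h1, h2, h3, h4, h5, h6, h7⟩ := h
  obtain ⟨z, w, a1, a2, a3, a4⟩ := three_step hc x u v y h1 h2 h3 h4 h5 h6
  rcases h7 z w a1 a2 a3 with ⟨rfl, rfl⟩ | ⟨rfl, rfl⟩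
  · exact Or.inl a4
  · exact Or.inr a4

/-- With three colors, a color avoiding two of three distinct colors is the third. -/
lemma third : ∀ a b d e : Fin 3, a ≠ b → a ≠ d → b ≠ d → e ≠ a → e ≠ b → e = d := by
  intro a b d e
  omega

lemma no_three (c : Fin 7 → Fin 7 → Fin 3) : ¬ IsStrongRainbowConnected exD c := by
  intro hc
  obtain ⟨a1, a2, a3⟩ := (or_self_iff.1 (three_or hc 5 0 3 0 3 6 (by decide)))
  obtain ⟨b1, b2, b3⟩ := (or_self_iff.1 (three_or hc 2 4 3 4 3 6 (by decide)))
  obtain ⟨d1, d2, d3⟩ := (or_self_iff.1 (three_or hc 5 0 2 0 2 4 (by decide)))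
  have e1 := two_uniq hc 0 2 5 (by decide)
  have e2 := two_uniq hc 2 5 0 (by decide)
  have e3 := two_uniq hc 3 6 4 (by decide)
  have e4 := two_uniq hc 6 4 3 (by decide)
  have e5 := two_uniq hc 6 4 5 (by decide)
  have e6 := two_uniq hc 4 5 0 (by decide)
  have e7 := two_uniq hc 4 3 1 (by decide)
  have f1 := three_or hc 3 1 2 6 4 5 (by decide)
  have f2 := three_or hc 4 3 1 5 0 2 (by decide)
  have t := third
  have c24 : c 2 4 = c 0 3 := t _ _ _ _ a2 a1 a3.symm d2.symm b2
  have c43 : c 4 3 = c 5 0 := t _ _ _ _ a3 a1.symm a2.symm (c24 ▸ b1.symm) b3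
  have c02 : c 0 2 = c 3 6 := t _ _ _ _ a1 a2 a3 d1.symm (c24 ▸ d3)
  have c25 : c 2 5 = c 0 3 := t _ _ _ _ a2 a1 a3.symm e2 (c02 ▸ e1.symm)
  have c64 : c 6 4 = c 0 3 := t _ _ _ _ a2 a1 a3.symm (c43 ▸ e4) e3.symm
  have c45 : c 4 5 = c 3 6 := t _ _ _ _ a1 a2 a3 e6 (c64 ▸ e5.symm)
  rcases f2 with ⟨g1, g2, g3⟩ | ⟨g1, g2, g3⟩
  · rcases f1 with ⟨k1, k2, k3⟩ | ⟨k1, k2, k3⟩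
    · have c31 : c 3 1 = c 3 6 := t _ _ _ _ a1 a2 a3 (c43 ▸ e7.symm) (c25 ▸ k2)
      have c12 : c 1 2 = c 5 0 := t _ _ _ _ a3 a1.symm a2.symm (c25 ▸ k3) (c31 ▸ k1.symm)
      exact g2 (c43.trans c12.symm)
    · exact k2 c45.symm
  · exact g2 (c45.trans c02.symm)

lemma RainbowPath.castLE {k m : ℕ} (h : k ≤ m) {c : V → V → Fin k} {p : List V}
    (hp : RainbowPath c p) : RainbowPath (fun x y => Fin.castLE h (c x y)) p := by
  have := List.Nodup.map (Fin.castLE_injective h) hp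
  rw [List.map_map] at this
  exact this

lemma connH : Connected exH := fun x y => ⟨geo x y, geo_path x y⟩

lemma connD : Connected exD := fun x y =>
  ⟨geo x y, List.IsChain.imp (fun a b h => exH_le a b h) (geo_chain x y),
    geo_head x y, geo_last x y⟩

/-- Geodesics of `D`: they differ from those of `H` for four pairs only. -/
def geoD (x y : Fin 7) : List (Fin 7) :=
  if x = 3 ∧ y = 4 then [3, 6, 4]
  else if x = 6 ∧ y = 3 then [6, 4, 3]
  else if x = 6 ∧ y = 4 then [6, 4]
  else if x = 6 ∧ y = 5 then [6, 4, 5]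
  else geo x y

/-- A coloring giving every arc its own color. -/
def colD (x y : Fin 7) : Fin 100 := Fin.ofNat 100 (10 * x.val + y.val)

lemma geoD_chain : ∀ x y : Fin 7, List.IsChain exD (geoD x y) := by decide

lemma geoD_head : ∀ x y : Fin 7, (geoD x y).head? = some x := by decide

lemma geoD_last : ∀ x y : Fin 7, (geoD x y).getLast? = some y := by decide

lemma geoD_rainbow : ∀ x y : Fin 7,
    (((geoD x y).zip (geoD x y).tail).map (fun e => colD e.1 e.2)).Nodup := by decide

lemma geoD_potential : ∀ x z y : Fin 7, exD x z →
    (geoD x y).length ≤ (geoD z y).length + 1 := by decide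

lemma geoD_self : ∀ y : Fin 7, (geoD y y).length = 1 := by decide

lemma exists_rainbow : ∃ k, ∃ c : Fin 7 → Fin 7 → Fin k, IsStrongRainbowConnected exD c :=
  have hp : ∀ x y, IsPathFrom exD x y (geoD x y) :=
    fun x y => ⟨geoD_chain x y, geoD_head x y, geoD_last x y⟩
  ⟨100, colD, fun x y _ => ⟨geoD x y, hp x y, geoD_rainbow x y,
    table_length hp geoD_potential geoD_self x y⟩⟩

lemma src_exD : 4 ≤ srcStar exD := by
  obtain ⟨c, hc⟩ : srcStar exD ∈ {k | ∃ c : Fin 7 → Fin 7 → Fin k, IsStrongRainbowConnected exD c} :=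
    Nat.sInf_mem (exists_rainbow)
  by_contra hlt
  refine no_three (fun x y => Fin.castLE (by omega) (c x y)) ?_
  intro x y hxy
  obtain ⟨p, p1, p2, p3⟩ := hc x y hxy
  exact ⟨p, p1, p2.castLE _, p3⟩

/-- There are a strongly connected digraph `D` and a strong spanning subdigraph
`H` of `D` with `src*(D) > src*(H)`. -/
theorem stmt2 : ∃ (n : ℕ) (D H : Fin n → Fin n → Prop),
    (∀ x y, H x y → D x y) ∧ Connected D ∧ Connected H ∧
    srcStar H < srcStar D :=
  ⟨7, exD, exH, exH_le, connD, connH, lt_of_le_of_lt src_exH src_exD⟩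

end RainbowDigraph
end

section
/- For every integer k ≥ 3, src*(C_{(k-1)^2}({1,k})) = rc*(C_{(k-1)^2}({1,k})) = 2k - 4, and if n = a·k with a ≥ k-1 ≥ 2, then src*(C_n({1,k})) = rc*(C_n({1,k})) = a + k - 2. -/
open scoped Classical

namespace RainbowDigraph

variable {V : Type}

/-! ### Words in the two letters `true` (step `k`) and `false` (step `1`) -/

/-- Step length of a letter. -/
def stp (k : ℕ) (b : Bool) : ℕ := if b then k else 1

/-- Total displacement of a word. -/
def disp (k : ℕ) : List Bool → ℕ
  | [] => 0
  | b :: w => stp k b + disp k w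

/-- Colors met along a word, starting at `v`. -/
def cl (f : Bool → ℕ → ℕ) (N k : ℕ) : ℕ → List Bool → List ℕ
  | _, [] => []
  | v, b :: w => f b (v % N) :: cl f N k (v + stp k b) w

/-- Vertices met along a word, starting at `v`. -/
def vl (N k : ℕ) : ℕ → List Bool → List (ZMod N)
  | v, [] => [(v : ZMod N)]
  | v, b :: w => (v : ZMod N) :: vl N k (v + stp k b) w

theorem vl_length (N k : ℕ) : ∀ (w : List Bool) (v : ℕ), (vl N k v w).length = w.length + 1
  | [], v => by simp [vl]
  | b :: w, v => by simp [vl, vl_length N k w]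

theorem vl_head (N k : ℕ) (w : List Bool) (v : ℕ) : (vl N k v w).head? = some (v : ZMod N) := by
  cases w <;> simp [vl]

theorem vl_cons (N k : ℕ) (w : List Bool) (v : ℕ) :
    ∃ t, vl N k v w = (v : ZMod N) :: t := by
  cases w <;> simp [vl]

theorem vl_path (N k : ℕ) : ∀ (w : List Bool) (v : ℕ),
    IsPathFrom (circulant N ({1, k} : Set ℕ)) (v : ZMod N) ((v + disp k w : ℕ) : ZMod N) (vl N k v w)
  | [], v => ⟨List.isChain_singleton _, by simp [vl], by simp [vl, disp]⟩
  | b :: w, v => by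
    obtain ⟨h1, h2, h3⟩ := vl_path N k w (v + stp k b)
    obtain ⟨t, ht⟩ := vl_cons N k w (v + stp k b)
    refine ⟨?_, vl_head _ _ _ _, ?_⟩
    · simp only [vl]
      rw [ht] at h1 ⊢
      refine List.isChain_cons_cons.2 ⟨?_, h1⟩
      refine ⟨stp k b, ?_, by push_cast; rfl⟩
      cases b <;> simp [stp]
    · simp only [vl, disp]
      rw [ht] at h3 ⊢
      rw [List.getLast?_cons_cons, h3, Nat.add_assoc]

theorem path_word (N k : ℕ) : ∀ (p : List (ZMod N)) (x y : ZMod N),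
    IsPathFrom (circulant N ({1, k} : Set ℕ)) x y p →
    ∃ w : List Bool, w.length + 1 = p.length ∧ y = x + (disp k w : ℕ)
  | [], x, y, h => by simp [IsPathFrom] at h
  | [u], x, y, h => by
    obtain ⟨_, h2, h3⟩ := h
    simp at h2 h3
    exact ⟨[], by simp, by simp [disp, ← h2, ← h3]⟩
  | u :: u' :: p, x, y, h => by
    obtain ⟨h1, h2, h3⟩ := h
    simp at h2
    have h1' := List.isChain_cons_cons.1 h1
    rw [List.getLast?_cons_cons] at h3
    obtain ⟨w, hw, hy⟩ := path_word N k (u' :: p) u' y ⟨h1'.2, by simp, h3⟩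
    obtain ⟨s, hs, hu⟩ := h1'.1
    rcases hs with hs | hs
    · refine ⟨false :: w, by simp at hw ⊢; omega, ?_⟩
      rw [hy, hu, ← h2, hs]; simp [disp, stp, add_assoc]
    · have hs' : s = k := hs
      refine ⟨true :: w, by simp at hw ⊢; omega, ?_⟩
      rw [hy, hu, ← h2, hs']; simp [disp, stp, add_assoc]

theorem disp_count (k : ℕ) : ∀ w : List Bool, ∃ x b : ℕ, w.length = x + b ∧ disp k w = x + b * k
  | [] => ⟨0, 0, by simp, by simp [disp]⟩
  | c :: w => by
    obtain ⟨x, b, h1, h2⟩ := disp_count k w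
    cases c
    · exact ⟨x + 1, b, by simp [h1]; omega, by simp [disp, stp, h2]; ring⟩
    · exact ⟨x, b + 1, by simp [h1]; omega, by simp [disp, stp, h2]; ring⟩

/-- The arc-coloring associated with `f`. -/
noncomputable def arcCol (N C : ℕ) (f : Bool → ℕ → ℕ) (hC : 0 < C) (u w : ZMod N) : Fin C :=
  if w = u + 1 then ⟨f false u.val % C, Nat.mod_lt _ hC⟩ else ⟨f true u.val % C, Nat.mod_lt _ hC⟩

theorem arcCol_step (N k C : ℕ) (hk : (k : ZMod N) ≠ 1) (f : Bool → ℕ → ℕ) (hC : 0 < C)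
    (hN : 0 < N) (hf : ∀ b v, v < N → f b v < C) (v : ℕ) (b : Bool) :
    (arcCol N C f hC (v : ZMod N) ((v + stp k b : ℕ) : ZMod N)).val = f b (v % N) := by
  have hlt : ∀ b, f b (v % N) % C = f b (v % N) :=
    fun b => Nat.mod_eq_of_lt (hf b _ (Nat.mod_lt _ hN))
  cases b
  · simp [arcCol, stp, ZMod.val_natCast, hlt]
  · simp [arcCol, stp, ZMod.val_natCast, hlt, hk]

theorem vl_colors (N k C : ℕ) (hk : (k : ZMod N) ≠ 1) (f : Bool → ℕ → ℕ) (hC : 0 < C)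
    (hN : 0 < N) (hf : ∀ b v, v < N → f b v < C) : ∀ (w : List Bool) (v : ℕ),
    (((vl N k v w).zip (vl N k v w).tail).map
      (fun e => arcCol N C f hC e.1 e.2)).map Fin.val = cl f N k v w
  | [], v => by simp [vl, cl]
  | b :: w, v => by
    obtain ⟨t, ht⟩ := vl_cons N k w (v + stp k b)
    have ih := vl_colors N k C hk f hC hN hf w (v + stp k b)
    simp only [vl, cl, List.tail_cons]
    rw [← ih, ht]
    simp only [List.zip_cons_cons, List.map_cons, List.tail_cons, arcCol_step N k C hk f hC hN hf]

theorem framework (N k C : ℕ) (hN : 0 < N) (hC : 0 < C) (hk : (k : ZMod N) ≠ 1)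
    (f : Bool → ℕ → ℕ) (hf : ∀ b v, v < N → f b v < C) (len : ℕ → ℕ)
    (hlow : ∀ d w, d < N → ((disp k w : ℕ) : ZMod N) = (d : ℕ) → len d ≤ w.length)
    (hup : ∀ v d, v < N → 0 < d → d < N → ∃ w : List Bool,
      ((disp k w : ℕ) : ZMod N) = (d : ℕ) ∧ w.length = len d ∧ (cl f N k v w).Nodup)
    (d₀ : ℕ) (hd₀ : d₀ < N) (hd₀' : C ≤ len d₀) (hlen0 : len 0 = 0) :
    srcStar (circulant N ({1, k} : Set ℕ)) = C ∧ rcStar (circulant N ({1, k} : Set ℕ)) = C := by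
  haveI : NeZero N := ⟨hN.ne'⟩
  have hdpos : 0 < d₀ := by
    rcases Nat.eq_zero_or_pos d₀ with h | h
    · subst h; omega
    · exact h
  have hstrong : IsStrongRainbowConnected (circulant N ({1, k} : Set ℕ)) (arcCol N C f hC) := by
    intro x y hxy
    have hd : (y - x).val < N := ZMod.val_lt _
    have hd0 : 0 < (y - x).val := by
      rw [ZMod.val_pos]; exact sub_ne_zero.2 (Ne.symm hxy)
    obtain ⟨w, h1, h2, h3⟩ := hup x.val (y - x).val (ZMod.val_lt _) hd0 hd
    have hy : ((x.val + disp k w : ℕ) : ZMod N) = y := by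
      push_cast; rw [h1]; simp
    have hP := vl_path N k w x.val
    rw [hy] at hP
    have hx : ((x.val : ℕ) : ZMod N) = x := by simp
    rw [hx] at hP
    refine ⟨vl N k x.val w, hP, ?_, ?_⟩
    · unfold RainbowPath
      apply List.Nodup.of_map Fin.val
      rw [vl_colors N k C hk f hC hN hf]
      exact h3
    · rw [vl_length]
      congr 1
      unfold dist
      apply le_antisymm
      · apply le_csInf
        · exact ⟨w.length, _, hP, vl_length _ _ _ _⟩
        · rintro m ⟨p, hp, hpl⟩
          obtain ⟨w', hw', hy'⟩ := path_word N k p x y hp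
          rw [h2]
          have := hlow (y - x).val w' hd (by rw [hy']; simp)
          omega
      · exact Nat.sInf_le ⟨_, hP, vl_length _ _ _ _⟩
  have hconn : IsRainbowConnected (circulant N ({1, k} : Set ℕ)) (arcCol N C f hC) := by
    intro x y hxy
    obtain ⟨p, h1, h2, _⟩ := hstrong x y hxy
    exact ⟨p, h1, h2⟩
  have hlower : ∀ K : ℕ, ∀ c : ZMod N → ZMod N → Fin K,
      IsRainbowConnected (circulant N ({1, k} : Set ℕ)) c → C ≤ K := by
    intro K c hc
    have hne : (0 : ZMod N) ≠ (d₀ : ZMod N) := by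
      intro h
      have := (ZMod.natCast_eq_zero_iff d₀ N).1 h.symm
      exact absurd (Nat.le_of_dvd hdpos this) (by omega)
    obtain ⟨p, hp, hr⟩ := hc _ _ hne
    obtain ⟨w, hw, hy⟩ := path_word N k p _ _ hp
    have := hlow d₀ w hd₀ (by rw [hy]; simp)
    have h4 := hr.length_le_card
    simp at h4
    omega
  constructor
  · apply le_antisymm
    · exact Nat.sInf_le ⟨_, hstrong⟩
    · apply le_csInf
      · exact ⟨C, _, hstrong⟩
      · rintro K ⟨c, hc⟩
        refine hlower K c ?_
        intro x y hxy
        obtain ⟨p, h1, h2, _⟩ := hc x y hxy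
        exact ⟨p, h1, h2⟩
  · apply le_antisymm
    · exact Nat.sInf_le ⟨_, hconn⟩
    · apply le_csInf
      · exact ⟨C, _, hconn⟩
      · rintro K ⟨c, hc⟩
        exact hlower K c hc

/-- Word made of five runs. -/
def word5 (x0 y1 x1 y2 x2 : ℕ) : List Bool :=
  List.replicate x0 false ++ (List.replicate y1 true ++ (List.replicate x1 false ++
    (List.replicate y2 true ++ (List.replicate x2 false ++ []))))

theorem disp_append (k : ℕ) : ∀ w w' : List Bool, disp k (w ++ w') = disp k w + disp k w'
  | [], w' => by simp [disp]
  | b :: w, w' => by simp [disp, disp_append k w w', add_assoc]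

theorem disp_replicate (k : ℕ) (b : Bool) : ∀ n : ℕ, disp k (List.replicate n b) = n * stp k b
  | 0 => by simp [disp]
  | n + 1 => by simp [List.replicate_succ, disp, disp_replicate k b n]; ring

theorem word5_disp (k x0 y1 x1 y2 x2 : ℕ) :
    disp k (word5 x0 y1 x1 y2 x2) = (x0 + x1 + x2) + (y1 + y2) * k := by
  simp [word5, disp_append, disp_replicate, stp]; ring

theorem word5_length (x0 y1 x1 y2 x2 : ℕ) :
    (word5 x0 y1 x1 y2 x2).length = x0 + y1 + x1 + y2 + x2 := by
  simp [word5]; ring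

theorem cl_run (f : Bool → ℕ → ℕ) (N k : ℕ) (b : Bool) (w : List Bool) : ∀ (n v : ℕ),
    cl f N k v (List.replicate n b ++ w) =
      (List.range n).map (fun t => f b ((v + t * stp k b) % N)) ++ cl f N k (v + n * stp k b) w
  | 0, v => by simp
  | n + 1, v => by
    rw [List.replicate_succ, List.cons_append, cl, cl_run f N k b w n, List.range_succ_eq_map]
    simp only [List.map_cons, List.map_map, List.cons_append]
    congr 1
    · simp
    · congr 1
      · apply List.map_congr_left
        intro t _
        simp only [Function.comp]
        congr 2; rw [Nat.succ_mul]; ring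
      · congr 1; ring

theorem nodup_run (n : ℕ) (F : ℕ → ℕ) (h : ∀ s t, s < t → t < n → F s ≠ F t) :
    ((List.range n).map F).Nodup := by
  apply List.Nodup.map_on _ List.nodup_range
  intro x hx y hy hxy
  simp at hx hy
  rcases lt_trichotomy x y with h1 | h1 | h1
  · exact absurd hxy (h _ _ h1 hy)
  · exact h1
  · exact absurd hxy.symm (h _ _ h1 hx)

theorem word5_nodup (f : Bool → ℕ → ℕ) (N k i j x0 y1 x1 y2 x2 : ℕ) (g : Bool → ℕ → ℕ → ℕ)
    (R : ℕ → ℕ → Prop) (hg : ∀ b I J, R I J → f b ((I * k + J) % N) = g b I J)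
    (r0 : ∀ t, t < x0 → R i (j + t))
    (r1 : ∀ t, t < y1 → R (i + t) (j + x0))
    (r2 : ∀ t, t < x1 → R (i + y1) (j + x0 + t))
    (r3 : ∀ t, t < y2 → R (i + y1 + t) (j + x0 + x1))
    (r4 : ∀ t, t < x2 → R (i + y1 + y2) (j + x0 + x1 + t))
    (h00 : ∀ s t, s < t → t < x0 → g false i (j + s) ≠ g false i (j + t))
    (h11 : ∀ s t, s < t → t < y1 → g true (i + s) (j + x0) ≠ g true (i + t) (j + x0))
    (h22 : ∀ s t, s < t → t < x1 → g false (i + y1) (j + x0 + s) ≠ g false (i + y1) (j + x0 + t))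
    (h33 : ∀ s t, s < t → t < y2 →
      g true (i + y1 + s) (j + x0 + x1) ≠ g true (i + y1 + t) (j + x0 + x1))
    (h44 : ∀ s t, s < t → t < x2 →
      g false (i + y1 + y2) (j + x0 + x1 + s) ≠ g false (i + y1 + y2) (j + x0 + x1 + t))
    (h01 : ∀ s t, s < x0 → t < y1 → g false i (j + s) ≠ g true (i + t) (j + x0))
    (h02 : ∀ s t, s < x0 → t < x1 → g false i (j + s) ≠ g false (i + y1) (j + x0 + t))
    (h03 : ∀ s t, s < x0 → t < y2 → g false i (j + s) ≠ g true (i + y1 + t) (j + x0 + x1))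
    (h04 : ∀ s t, s < x0 → t < x2 → g false i (j + s) ≠ g false (i + y1 + y2) (j + x0 + x1 + t))
    (h12 : ∀ s t, s < y1 → t < x1 → g true (i + s) (j + x0) ≠ g false (i + y1) (j + x0 + t))
    (h13 : ∀ s t, s < y1 → t < y2 → g true (i + s) (j + x0) ≠ g true (i + y1 + t) (j + x0 + x1))
    (h14 : ∀ s t, s < y1 → t < x2 →
      g true (i + s) (j + x0) ≠ g false (i + y1 + y2) (j + x0 + x1 + t))
    (h23 : ∀ s t, s < x1 → t < y2 →
      g false (i + y1) (j + x0 + s) ≠ g true (i + y1 + t) (j + x0 + x1))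
    (h24 : ∀ s t, s < x1 → t < x2 →
      g false (i + y1) (j + x0 + s) ≠ g false (i + y1 + y2) (j + x0 + x1 + t))
    (h34 : ∀ s t, s < y2 → t < x2 →
      g true (i + y1 + s) (j + x0 + x1) ≠ g false (i + y1 + y2) (j + x0 + x1 + t)) :
    (cl f N k (i * k + j) (word5 x0 y1 x1 y2 x2)).Nodup := by
  have e0 : (List.range x0).map (fun t => f false ((i * k + j + t * stp k false) % N)) =
      (List.range x0).map (fun t => g false i (j + t)) := by
    apply List.map_congr_left
    intro t ht
    rw [← hg _ _ _ (r0 t (by simpa using ht))]; congr 2; simp [stp]; ring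
  have e1 : (List.range y1).map (fun t => f true ((i * k + j + x0 * stp k false +
      t * stp k true) % N)) = (List.range y1).map (fun t => g true (i + t) (j + x0)) := by
    apply List.map_congr_left
    intro t ht
    rw [← hg _ _ _ (r1 t (by simpa using ht))]; congr 2; simp [stp]; ring
  have e2 : (List.range x1).map (fun t => f false ((i * k + j + x0 * stp k false +
      y1 * stp k true + t * stp k false) % N)) =
      (List.range x1).map (fun t => g false (i + y1) (j + x0 + t)) := by
    apply List.map_congr_left
    intro t ht
    rw [← hg _ _ _ (r2 t (by simpa using ht))]; congr 2; simp [stp]; ring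
  have e3 : (List.range y2).map (fun t => f true ((i * k + j + x0 * stp k false +
      y1 * stp k true + x1 * stp k false + t * stp k true) % N)) =
      (List.range y2).map (fun t => g true (i + y1 + t) (j + x0 + x1)) := by
    apply List.map_congr_left
    intro t ht
    rw [← hg _ _ _ (r3 t (by simpa using ht))]; congr 2; simp [stp]; ring
  have e4 : (List.range x2).map (fun t => f false ((i * k + j + x0 * stp k false +
      y1 * stp k true + x1 * stp k false + y2 * stp k true + t * stp k false) % N)) =
      (List.range x2).map (fun t => g false (i + y1 + y2) (j + x0 + x1 + t)) := by
    apply List.map_congr_left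
    intro t ht
    rw [← hg _ _ _ (r4 t (by simpa using ht))]; congr 2; simp [stp]; ring
  unfold word5
  rw [cl_run, cl_run, cl_run, cl_run, cl_run, e0, e1, e2, e3, e4]
  simp only [cl, List.append_nil, List.nodup_append, List.mem_append, List.mem_map,
    List.mem_range]
  refine ⟨nodup_run _ _ h00, ⟨nodup_run _ _ h11, ⟨nodup_run _ _ h22,
    ⟨nodup_run _ _ h33, nodup_run _ _ h44, ?_⟩, ?_⟩, ?_⟩, ?_⟩
  · rintro _ ⟨s, hs, rfl⟩ _ ⟨t, ht, rfl⟩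
    exact h34 s t hs ht
  · rintro _ ⟨s, hs, rfl⟩ _ (⟨t, ht, rfl⟩ | ⟨t, ht, rfl⟩)
    · exact h23 s t hs ht
    · exact h24 s t hs ht
  · rintro _ ⟨s, hs, rfl⟩ _ (⟨t, ht, rfl⟩ | ⟨t, ht, rfl⟩ | ⟨t, ht, rfl⟩)
    · exact h12 s t hs ht
    · exact h13 s t hs ht
    · exact h14 s t hs ht
  · rintro _ ⟨s, hs, rfl⟩ _ (⟨t, ht, rfl⟩ | ⟨t, ht, rfl⟩ | ⟨t, ht, rfl⟩ | ⟨t, ht, rfl⟩)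
    · exact h01 s t hs ht
    · exact h02 s t hs ht
    · exact h03 s t hs ht
    · exact h04 s t hs ht

/-! ### Case `n = a k` -/

theorem low2 (a k d : ℕ) (w : List Bool) (hk : 0 < k) (hd : d < a * k)
    (h : ((disp k w : ℕ) : ZMod (a * k)) = (d : ℕ)) : d / k + d % k ≤ w.length := by
  obtain ⟨x, b, h1, h2⟩ := disp_count k w
  rw [ZMod.natCast_eq_natCast_iff, h2] at h
  have hx : x % k = d % k := by
    have := h.of_mul_left a
    unfold Nat.ModEq at this
    simpa using this
  have hq : d / k < a := Nat.div_lt_of_lt_mul (by rw [mul_comm]; exact hd)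
  have ex := Nat.div_add_mod x k
  have ed := Nat.div_add_mod d k
  have h3 : (x / k + b) ≡ d / k [MOD a] := by
    have h4 : (x / k + b) * k + d % k ≡ (d / k) * k + d % k [MOD a * k] := by
      have e1 : (x / k + b) * k + d % k = x + b * k := by rw [← hx]; nlinarith
      have e2 : (d / k) * k + d % k = d := by nlinarith
      rw [e1, e2]; exact h
    exact Nat.ModEq.mul_right_cancel' hk.ne' (Nat.ModEq.add_right_cancel' _ h4)
  have h5 : d / k ≤ x / k + b := by
    have := h3.symm
    unfold Nat.ModEq at this
    rw [Nat.mod_eq_of_lt hq] at this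
    rw [this]; exact Nat.mod_le _ _
  have h6 : x / k + x % k ≤ x := by
    have : x / k ≤ k * (x / k) := Nat.le_mul_of_pos_left _ hk
    omega
  omega

/-- Canonical colors of the arcs leaving the vertex in row `i`, column `j`. -/
def c2 (a k : ℕ) (b : Bool) (i j : ℕ) : ℕ :=
  if b then i
  else if i = 0 then (if j = 0 then a - 1 else if j + 1 = k then 0 else a + j - 1)
  else if j + 2 = k then i - 1
  else if j + 1 = k then (if i + 1 = a then (if a = 2 then a + k - 3 else 0) else i)
  else a + j

/-- Row reduction. -/
def g2 (a k : ℕ) (b : Bool) (I J : ℕ) : ℕ :=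
  if J < k then (if I < a then c2 a k b I J else c2 a k b (I - a) J)
  else (if I + 1 < a then c2 a k b (I + 1) (J - k) else c2 a k b (I + 1 - a) (J - k))

def R2 (a k I J : ℕ) : Prop := (J < k ∧ I < 2 * a) ∨ (k ≤ J ∧ J < 2 * k ∧ I + 1 < 2 * a)

def row2 (a k I J p u : ℕ) : Prop :=
  (J < k ∧ I < a ∧ p = I ∧ u = J) ∨ (J < k ∧ a ≤ I ∧ p + a = I ∧ u = J) ∨
  (k ≤ J ∧ I + 1 < a ∧ p = I + 1 ∧ u + k = J) ∨ (k ≤ J ∧ a ≤ I + 1 ∧ p + a = I + 1 ∧ u + k = J)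

def col2 (a k p u c : ℕ) : Prop :=
  (p = 0 ∧ u = 0 ∧ c + 1 = a) ∨ (p = 0 ∧ u + 1 = k ∧ c = 0) ∨
  (p = 0 ∧ 0 < u ∧ u + 1 < k ∧ c + 1 = a + u) ∨
  (0 < p ∧ u + 2 < k ∧ c = a + u) ∨ (0 < p ∧ u + 2 = k ∧ c + 1 = p) ∨
  (0 < p ∧ u + 1 = k ∧ p + 1 < a ∧ c = p) ∨
  (0 < p ∧ u + 1 = k ∧ p + 1 = a ∧ ((a = 2 ∧ c + 3 = a + k) ∨ (2 < a ∧ c = 0)))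

theorem row2_exists (a k I J : ℕ) (h : R2 a k I J) :
    ∃ p u, row2 a k I J p u ∧ p < a ∧ u < k ∧ ∀ b, g2 a k b I J = c2 a k b p u := by
  unfold R2 at h
  by_cases h1 : J < k
  · by_cases h2 : I < a
    · exact ⟨I, J, by unfold row2; omega, h2, h1, fun b => by simp [g2, h1, h2]⟩
    · exact ⟨I - a, J, by unfold row2; omega, by omega, h1, fun b => by simp [g2, h1, h2]⟩
  · by_cases h2 : I + 1 < a
    · exact ⟨I + 1, J - k, by unfold row2; omega, h2, by omega, fun b => by simp [g2, h1, h2]⟩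
    · exact ⟨I + 1 - a, J - k, by unfold row2; omega, by omega, by omega,
        fun b => by simp [g2, h1, h2]⟩

theorem col2_spec (a k p u : ℕ) (hk : 3 ≤ k) (ha : 2 ≤ a) (hp : p < a) (hu : u < k) :
    col2 a k p u (c2 a k false p u) := by
  unfold col2 c2
  simp only [Bool.false_eq_true, if_false]
  split_ifs <;> first
    | exact Or.inl (by omega)
    | exact Or.inr (Or.inl (by omega))
    | exact Or.inr (Or.inr (Or.inl (by omega)))
    | exact Or.inr (Or.inr (Or.inr (Or.inl (by omega))))
    | exact Or.inr (Or.inr (Or.inr (Or.inr (Or.inl (by omega)))))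
    | exact Or.inr (Or.inr (Or.inr (Or.inr (Or.inr (Or.inl (by omega))))))
    | exact Or.inr (Or.inr (Or.inr (Or.inr (Or.inr (Or.inr (by omega))))))

theorem c2_lt (a k p u : ℕ) (b : Bool) (hk : 3 ≤ k) (ha : 2 ≤ a) (hp : p < a) (hu : u < k) :
    c2 a k b p u < a + k - 2 := by
  unfold c2
  split_ifs <;> omega

def f2 (a k : ℕ) (b : Bool) (v : ℕ) : ℕ := c2 a k b (v / k) (v % k)

theorem f2_eq (a k I J : ℕ) (b : Bool) (hk : 3 ≤ k) (h : R2 a k I J) :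
    f2 a k b ((I * k + J) % (a * k)) = g2 a k b I J := by
  obtain ⟨p, u, h1, hp, hu, h2⟩ := row2_exists a k I J h
  have hlt : p * k + u < a * k := by nlinarith
  have key : (I * k + J) % (a * k) = p * k + u := by
    rcases h1 with ⟨_, _, rfl, rfl⟩ | ⟨_, _, rfl, rfl⟩ | ⟨_, _, rfl, rfl⟩ | ⟨_, _, h3, rfl⟩
    · exact Nat.mod_eq_of_lt hlt
    · rw [show (p + a) * k + u = p * k + u + a * k by ring, Nat.add_mod_right]
      exact Nat.mod_eq_of_lt hlt
    · rw [show I * k + (u + k) = (I + 1) * k + u by ring]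
      exact Nat.mod_eq_of_lt hlt
    · rw [show I * k + (u + k) = (I + 1) * k + u by ring, ← h3,
        show (p + a) * k + u = p * k + u + a * k by ring, Nat.add_mod_right]
      exact Nat.mod_eq_of_lt hlt
  have hk0 : 0 < k := by omega
  rw [key, h2, f2, Nat.mul_comm p k, Nat.mul_add_div hk0, Nat.div_eq_of_lt hu, Nat.mul_add_mod,
    Nat.mod_eq_of_lt hu, Nat.add_zero]

theorem ss2 (a k I J I' J' : ℕ) (hk : 3 ≤ k) (ha : 2 ≤ a) (h : R2 a k I J) (h' : R2 a k I' J')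
    (H : ∀ p u p' u' c, row2 a k I J p u → row2 a k I' J' p' u' → p < a → u < k → p' < a → u' < k →
      col2 a k p u c → col2 a k p' u' c → False) : g2 a k false I J ≠ g2 a k false I' J' := by
  obtain ⟨p, u, h1, hp, hu, h2⟩ := row2_exists a k I J h
  obtain ⟨p', u', h1', hp', hu', h2'⟩ := row2_exists a k I' J' h'
  intro heq
  refine H p u p' u' _ h1 h1' hp hu hp' hu' (col2_spec a k p u hk ha hp hu) ?_
  rw [← h2, heq, h2']
  exact col2_spec a k p' u' hk ha hp' hu'

theorem sb2 (a k I J I' J' : ℕ) (hk : 3 ≤ k) (ha : 2 ≤ a) (h : R2 a k I J) (h' : R2 a k I' J')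
    (H : ∀ p u p' u', row2 a k I J p u → row2 a k I' J' p' u' → p < a → u < k → p' < a → u' < k →
      col2 a k p u p' → False) : g2 a k false I J ≠ g2 a k true I' J' := by
  obtain ⟨p, u, h1, hp, hu, h2⟩ := row2_exists a k I J h
  obtain ⟨p', u', h1', hp', hu', h2'⟩ := row2_exists a k I' J' h'
  intro heq
  refine H p u p' u' h1 h1' hp hu hp' hu' ?_
  have := col2_spec a k p u hk ha hp hu
  rw [← h2, heq, h2'] at this
  simpa [c2] using this

theorem bb2 (a k I J I' J' : ℕ) (h : R2 a k I J) (h' : R2 a k I' J')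
    (H : ∀ p u p' u', row2 a k I J p u → row2 a k I' J' p' u' → p = p' → False) :
    g2 a k true I J ≠ g2 a k true I' J' := by
  obtain ⟨p, u, h1, hp, hu, h2⟩ := row2_exists a k I J h
  obtain ⟨p', u', h1', hp', hu', h2'⟩ := row2_exists a k I' J' h'
  intro heq
  refine H p u p' u' h1 h1' ?_
  rw [h2, h2'] at heq
  simpa [c2] using heq

set_option maxHeartbeats 4000000 in
/-- Words `B^y S^r B^z`. -/
theorem bsb2 (a k i j y r z : ℕ) (hk : 3 ≤ k) (ha : 2 ≤ a) (hak : k ≤ a + 1) (hi : i < a) (hj : j < k)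
    (hr : r < k) (hq : y + z < a)
    (hcond : (j + r < k ∧ y = 0) ∨ (k ≤ j + r ∧
      ((i = 0 ∧ y = 0) ∨ (i + 1 = a ∧ y = 1) ∨ (i + 1 = a ∧ y = 0 ∧ z = 0) ∨
       (0 < i ∧ i + 1 < a ∧ j + 1 = k ∧ y = 0) ∨
       (0 < i ∧ i + 1 < a ∧ j + 1 < k ∧ y = 0 ∧ z + 1 < a) ∨
       (0 < i ∧ i + 1 < a ∧ j + 1 < k ∧ y + i = a ∧ z + 1 = i)))) :
    (cl (f2 a k) (a * k) k (i * k + j) (word5 0 y r z 0)).Nodup := by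
  have hR : ∀ I J, I ≤ i + y + z → J ≤ j + r → I < i + y + z ∨ J < j + r → R2 a k I J := by
    intro I J h1 h2 h3
    unfold R2
    omega
  refine word5_nodup (f2 a k) (a * k) k i j 0 y r z 0 (g2 a k) (R2 a k)
    (fun b I J h => f2_eq a k I J b hk h) ?_ ?_ ?_ ?_ ?_ ?_ ?_ ?_ ?_ ?_ ?_ ?_ ?_ ?_ ?_ ?_ ?_ ?_ ?_ ?_
  · intro t ht; omega
  · intro t ht; apply hR <;> omega
  · intro t ht; apply hR <;> omega
  · intro t ht; apply hR <;> omega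
  · intro t ht; omega
  · intro s t hs ht; omega
  · intro s t hs ht
    refine bb2 a k _ _ _ _ (hR _ _ (by omega) (by omega) (by omega)) (hR _ _ (by omega) (by omega) (by omega)) ?_
    intro p u p' u' h1 h2 h3
    clear hR
    unfold row2 at h1 h2
    omega
  · intro s t hs ht
    refine ss2 a k _ _ _ _ hk ha (hR _ _ (by omega) (by omega) (by omega)) (hR _ _ (by omega) (by omega) (by omega)) ?_
    intro p u p' u' c h1 h2 _ _ _ _ h3 h4
    clear hR
    unfold row2 at h1 h2
    unfold col2 at h3 h4
    clear hq
    have hI : i + y < a ∧ i + y = i + y ∨ a ≤ i + y ∧ i + y = a := by omega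
    revert h4
    rcases h1 with h1 | h1 | h1 | h1 <;> rcases h2 with h2 | h2 | h2 | h2 <;>
      first
      | (intro h4; clear h3 h4; omega)
      | (rcases h3 with h3 | h3 | h3 | h3 | h3 | h3 | h3 <;>
          first
          | (intro h4; clear h4; omega)
          | (intro h4
             rcases h4 with h4 | h4 | h4 | h4 | h4 | h4 | h4 <;> omega))
  · intro s t hs ht
    refine bb2 a k _ _ _ _ (hR _ _ (by omega) (by omega) (by omega)) (hR _ _ (by omega) (by omega) (by omega)) ?_
    intro p u p' u' h1 h2 h3
    clear hR
    unfold row2 at h1 h2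
    omega
  · intro s t hs ht; omega
  · intro s t hs ht; omega
  · intro s t hs ht; omega
  · intro s t hs ht; omega
  · intro s t hs ht; omega
  · intro s t hs ht
    refine (sb2 a k _ _ _ _ hk ha (hR _ _ (by omega) (by omega) (by omega)) (hR _ _ (by omega) (by omega) (by omega)) ?_).symm
    intro p u p' u' h1 h2 _ _ _ _ h3
    clear hR
    unfold row2 at h1 h2
    unfold col2 at h3
    rcases h1 with h1 | h1 | h1 | h1 <;> rcases h2 with h2 | h2 | h2 | h2 <;>
      first
      | (clear h3; omega)
      | (rcases h3 with h3 | h3 | h3 | h3 | h3 | h3 | h3 <;> omega)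
  · intro s t hs ht
    refine bb2 a k _ _ _ _ (hR _ _ (by omega) (by omega) (by omega)) (hR _ _ (by omega) (by omega) (by omega)) ?_
    intro p u p' u' h1 h2 h3
    clear hR
    unfold row2 at h1 h2
    omega
  · intro s t hs ht; omega
  · intro s t hs ht
    refine sb2 a k _ _ _ _ hk ha (hR _ _ (by omega) (by omega) (by omega)) (hR _ _ (by omega) (by omega) (by omega)) ?_
    intro p u p' u' h1 h2 _ _ _ _ h3
    clear hR
    unfold row2 at h1 h2
    unfold col2 at h3
    rcases h1 with h1 | h1 | h1 | h1 <;> rcases h2 with h2 | h2 | h2 | h2 <;>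
      first
      | (clear h3; omega)
      | (rcases h3 with h3 | h3 | h3 | h3 | h3 | h3 | h3 <;> omega)
  · intro s t hs ht; omega
  · intro s t hs ht; omega

theorem k_ne_one (N k : ℕ) (hk : 1 < k) (hkN : k < N) : (k : ZMod N) ≠ 1 := by
  intro h
  have h1 : ((k : ℕ) : ZMod N) = ((1 : ℕ) : ZMod N) := by simpa using h
  rw [ZMod.natCast_eq_natCast_iff] at h1
  unfold Nat.ModEq at h1
  rw [Nat.mod_eq_of_lt hkN, Nat.mod_eq_of_lt (by omega)] at h1
  omega

theorem case2 (a k : ℕ) (hk : 3 ≤ k) (hak : k ≤ a + 1) :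
    srcStar (circulant (a * k) ({1, k} : Set ℕ)) = a + k - 2 ∧
    rcStar (circulant (a * k) ({1, k} : Set ℕ)) = a + k - 2 := by
  have ha : 2 ≤ a := by omega
  have hk0 : 0 < k := by omega
  have hkN : k < a * k := by nlinarith
  have hlast : (a - 1) * k + (k - 1) < a * k := by
    obtain ⟨a', rfl⟩ : ∃ a', a = a' + 1 := ⟨a - 1, by omega⟩
    rw [Nat.add_sub_cancel, Nat.succ_mul]; omega
  refine framework (a * k) k (a + k - 2) (by omega) (by omega) (k_ne_one _ _ (by omega) hkN)
    (f2 a k) ?_ (fun d => d / k + d % k) (fun d w hd h => low2 a k d w hk0 hd h) ?_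
    ((a - 1) * k + (k - 1)) hlast ?_ (by simp)
  · intro b v hv
    exact c2_lt a k _ _ b hk ha (Nat.div_lt_of_lt_mul (by rw [mul_comm]; exact hv))
      (Nat.mod_lt _ hk0)
  · intro v d hv _ hd
    have hi : v / k < a := Nat.div_lt_of_lt_mul (by rw [mul_comm]; exact hv)
    have hj : v % k < k := Nat.mod_lt _ hk0
    have hq : d / k < a := Nat.div_lt_of_lt_mul (by rw [mul_comm]; exact hd)
    have hr : d % k < k := Nat.mod_lt _ hk0
    have ev : v = v / k * k + v % k := by rw [mul_comm]; exact (Nat.div_add_mod v k).symm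
    have ed : d = d / k * k + d % k := by rw [mul_comm]; exact (Nat.div_add_mod d k).symm
    suffices h : ∃ y z, y + z = d / k ∧
        (cl (f2 a k) (a * k) k (v / k * k + v % k) (word5 0 y (d % k) z 0)).Nodup by
      obtain ⟨y, z, hyz, hN⟩ := h
      refine ⟨word5 0 y (d % k) z 0, ?_, ?_, ?_⟩
      · rw [word5_disp, hyz]; congr 1; omega
      · rw [word5_length]; omega
      · rw [ev]; exact hN
    generalize v / k = i at *
    generalize v % k = j at *
    generalize d / k = q at *
    generalize d % k = r at *
    have main : ∃ y z, y + z = q ∧ ((j + r < k ∧ y = 0) ∨ (k ≤ j + r ∧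
      ((i = 0 ∧ y = 0) ∨ (i + 1 = a ∧ y = 1) ∨ (i + 1 = a ∧ y = 0 ∧ z = 0) ∨
       (0 < i ∧ i + 1 < a ∧ j + 1 = k ∧ y = 0) ∨
       (0 < i ∧ i + 1 < a ∧ j + 1 < k ∧ y = 0 ∧ z + 1 < a) ∨
       (0 < i ∧ i + 1 < a ∧ j + 1 < k ∧ y + i = a ∧ z + 1 = i)))) := by
      by_cases h1 : (i + 1 = a ∧ 0 < q ∧ k ≤ j + r ∧ 0 < i)
      · exact ⟨1, q - 1, by omega, by omega⟩
      · by_cases h2 : (0 < i ∧ i + 1 < a ∧ j + 1 < k ∧ q + 1 = a ∧ k ≤ j + r)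
        · exact ⟨a - i, i - 1, by omega, by omega⟩
        · exact ⟨0, q, by omega, by omega⟩
    obtain ⟨y, z, hyz, hc⟩ := main
    exact ⟨y, z, hyz, bsb2 a k i j y r z hk ha hak hi hj hr (by omega) hc⟩
  · show a + k - 2 ≤ ((a - 1) * k + (k - 1)) / k + ((a - 1) * k + (k - 1)) % k
    rw [Nat.mul_comm, Nat.mul_add_div hk0, Nat.div_eq_of_lt (by omega), Nat.mul_add_mod,
      Nat.mod_eq_of_lt (by omega)]
    omega

/-! ### Case `n = m ^ 2`, `k = m + 1` -/

theorem low1 (m d : ℕ) (w : List Bool) (hm : 2 ≤ m) (hd : d < m ^ 2)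
    (h : ((disp (m + 1) w : ℕ) : ZMod (m ^ 2)) = (d : ℕ)) :
    d / (m + 1) + d % (m + 1) ≤ w.length := by
  obtain ⟨x, b, h1, h2⟩ := disp_count (m + 1) w
  rw [ZMod.natCast_eq_natCast_iff, h2] at h
  have hr : d % (m + 1) < m + 1 := Nat.mod_lt _ (by omega)
  have ed := Nat.div_add_mod d (m + 1)
  generalize d / (m + 1) = q at *
  generalize d % (m + 1) = r at *
  have hq : q + 1 < m ∨ (q + 1 = m ∧ r = 0) := by
    by_contra hc
    push Not at hc
    obtain ⟨hc1, hc2⟩ := hc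
    rcases Nat.lt_or_ge (q + 1) (m + 1) with h3 | h3
    · have h4 : q + 1 = m := by omega
      have h5 : 1 ≤ r := Nat.one_le_iff_ne_zero.2 (hc2 h4)
      subst h4
      nlinarith
    · have : m ≤ q := by omega
      nlinarith
  have hz := (Nat.modEq_iff_dvd.1 h)
  obtain ⟨z, hz⟩ := hz
  subst ed
  push_cast at hz
  rw [h1]
  by_contra hlt
  push Not at hlt
  have hu : ((q : ℤ) + r) - (x + b) = m * (z * m - q + b) := by linear_combination hz
  have hx0 : (0 : ℤ) ≤ x := by positivity
  have hb0 : (0 : ℤ) ≤ b := by positivity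
  have hq0 : (0 : ℤ) ≤ q := by positivity
  have hmz : (2 : ℤ) ≤ m := by exact_mod_cast hm
  have hltz : (x : ℤ) + b < q + r := by exact_mod_cast hlt
  have hqr : (q : ℤ) + r ≤ 2 * m - 2 := by omega
  set U : ℤ := z * m - q + b with hU
  have hU1 : 0 < U := by
    by_contra hh
    push Not at hh
    nlinarith
  have hU2 : U < 2 := by
    by_contra hh
    push Not at hh
    nlinarith
  have hU3 : U = 1 := by omega
  rw [hU3] at hu
  have hbq : (b : ℤ) ≤ q := by omega
  have hz1 : 0 < z := by
    by_contra hh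
    push Not at hh
    have : z * m ≤ 0 := by nlinarith
    omega
  have : (m : ℤ) ≤ z * m := by nlinarith
  omega

/-- Canonical colors of the arcs leaving the vertex in row `i`, column `j`. -/
def c1 (m : ℕ) (b : Bool) (i j : ℕ) : ℕ :=
  if b then
    (if i + 1 = m then 1 else if i + 2 = m ∧ j = 0 then 0 else m - 1 + i)
  else if i = 0 ∧ j = 0 then m - 1
  else if i + 1 = m then 2 * m - 3
  else if i + j + 1 < m then i + j
  else if i + j + 1 = m then m - 1 + i
  else i + j - m

def R1 (m I J : ℕ) : Prop :=
  (J ≤ m ∧ I + 3 ≤ 2 * m) ∨ (m < J ∧ J ≤ 2 * m ∧ I + 4 ≤ 2 * m) ∨ (J = 1 ∧ I + 2 = 2 * m)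

def row1 (m I J p u : ℕ) : Prop :=
  (J ≤ m ∧ I + 1 < m ∧ p = I ∧ u = J) ∨
  (J ≤ m ∧ 1 ≤ J ∧ m ≤ I + 1 ∧ p + m = I + 1 ∧ u + 1 = J) ∨
  (J = 0 ∧ I + 1 = m ∧ p = I ∧ u = 0) ∨
  (J = 0 ∧ m ≤ I ∧ p + m = I ∧ u = m) ∨
  (m < J ∧ I + 2 < m ∧ p = I + 1 ∧ u + m + 1 = J) ∨
  (m + 2 ≤ J ∧ m ≤ I + 2 ∧ p + m = I + 2 ∧ u + m + 2 = J) ∨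
  (J = m + 1 ∧ I + 2 = m ∧ p = I + 1 ∧ u = 0) ∨
  (J = m + 1 ∧ m ≤ I + 1 ∧ p + m = I + 1 ∧ u = m)

/-- Canonical positions. -/
def can1 (m p u : ℕ) : Prop := (p + 1 < m ∧ u ≤ m) ∨ (p + 1 = m ∧ u = 0)

def colS (m p u c : ℕ) : Prop :=
  (p = 0 ∧ u = 0 ∧ c + 1 = m) ∨ (p + 1 = m ∧ u = 0 ∧ c + 3 = 2 * m) ∨
  (p + 1 < m ∧ p + u + 1 < m ∧ 0 < p + u ∧ c = p + u) ∨
  (p + 1 < m ∧ p + u + 1 = m ∧ c + 1 = m + p) ∨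
  (p + 1 < m ∧ m ≤ p + u ∧ u ≤ m ∧ c + m = p + u)

def colB (m p u c : ℕ) : Prop :=
  (p + 1 = m ∧ u = 0 ∧ c = 1) ∨ (p + 2 = m ∧ u = 0 ∧ c = 0) ∨
  (p + 2 < m ∧ u ≤ m ∧ c + 1 = m + p) ∨ (p + 2 = m ∧ 0 < u ∧ u ≤ m ∧ c + 1 = m + p)

theorem colS_spec (m p u : ℕ) (hm : 4 ≤ m) (h : can1 m p u) : colS m p u (c1 m false p u) := by
  unfold can1 at h
  unfold colS c1
  simp only [Bool.false_eq_true, if_false]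
  split_ifs <;> first
    | exact Or.inl (by omega)
    | exact Or.inr (Or.inl (by omega))
    | exact Or.inr (Or.inr (Or.inl (by omega)))
    | exact Or.inr (Or.inr (Or.inr (Or.inl (by omega))))
    | exact Or.inr (Or.inr (Or.inr (Or.inr (by omega))))

theorem colB_spec (m p u : ℕ) (hm : 4 ≤ m) (h : can1 m p u) : colB m p u (c1 m true p u) := by
  unfold can1 at h
  unfold colB c1
  simp only [if_true]
  split_ifs <;> first
    | exact Or.inl (by omega)
    | exact Or.inr (Or.inl (by omega))
    | (rcases Nat.lt_or_ge (p + 2) m with h3 | h3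
       · exact Or.inr (Or.inr (Or.inl (by omega)))
       · exact Or.inr (Or.inr (Or.inr (by omega))))

theorem c1_lt (m p u : ℕ) (b : Bool) (hm : 4 ≤ m) (h : can1 m p u) : c1 m b p u < 2 * m - 2 := by
  unfold can1 at h
  unfold c1
  split_ifs <;> omega

theorem row1_exists (m I J : ℕ) (hm : 4 ≤ m) (h : R1 m I J) :
    ∃ p u, row1 m I J p u ∧ can1 m p u := by
  unfold R1 at h
  rcases Nat.lt_or_ge m J with h1 | h1
  · rcases Nat.lt_or_ge (I + 2) m with h2 | h2
    · exact ⟨I + 1, J - m - 1, Or.inr (Or.inr (Or.inr (Or.inr (Or.inl (by omega))))), by unfold can1; omega⟩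
    · rcases Nat.lt_or_ge J (m + 2) with h3 | h3
      · rcases Nat.lt_or_ge m (I + 2) with h4 | h4
        · exact ⟨I + 1 - m, m, Or.inr (Or.inr (Or.inr (Or.inr (Or.inr (Or.inr (Or.inr ((by omega)))))))), by unfold can1; omega⟩
        · exact ⟨I + 1, 0, Or.inr (Or.inr (Or.inr (Or.inr (Or.inr (Or.inr (Or.inl (by omega))))))), by unfold can1; omega⟩
      · exact ⟨I + 2 - m, J - m - 2, Or.inr (Or.inr (Or.inr (Or.inr (Or.inr (Or.inl (by omega)))))), by unfold can1; omega⟩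
  · rcases Nat.lt_or_ge (I + 1) m with h2 | h2
    · exact ⟨I, J, Or.inl (by omega), by unfold can1; omega⟩
    · rcases Nat.lt_or_ge J 1 with h3 | h3
      · rcases Nat.lt_or_ge m (I + 1) with h4 | h4
        · exact ⟨I - m, m, Or.inr (Or.inr (Or.inr (Or.inl (by omega)))), by unfold can1; omega⟩
        · exact ⟨I, 0, Or.inr (Or.inr (Or.inl (by omega))), by unfold can1; omega⟩
      · exact ⟨I + 1 - m, J - 1, Or.inr (Or.inl (by omega)), by unfold can1; omega⟩

def f1 (m : ℕ) (b : Bool) (v : ℕ) : ℕ := c1 m b (v / (m + 1)) (v % (m + 1))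

/-- Color at unreduced coordinates. -/
def g1 (m : ℕ) (b : Bool) (I J : ℕ) : ℕ := f1 m b ((I * (m + 1) + J) % (m ^ 2))

theorem g1_eq (m I J p u : ℕ) (b : Bool) (hm : 4 ≤ m) (h : row1 m I J p u) (hc : can1 m p u) :
    g1 m b I J = c1 m b p u := by
  have hlt : p * (m + 1) + u < m ^ 2 := by
    rcases hc with ⟨h1, h2⟩ | ⟨h1, h2⟩
    · obtain ⟨e, rfl⟩ : ∃ e, m = p + 2 + e := ⟨m - (p + 2), by omega⟩
      nlinarith
    · subst h1; nlinarith
  have hu : u < m + 1 := by unfold can1 at hc; omega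
  have key : (I * (m + 1) + J) % (m ^ 2) = p * (m + 1) + u := by
    have e : ∃ z, I * (m + 1) + J = p * (m + 1) + u + m ^ 2 * z := by
      unfold row1 at h
      rcases h with h | h | h | h | h | h | h | h
      · obtain ⟨_, _, rfl, rfl⟩ := h
        exact ⟨0, by ring⟩
      · obtain ⟨_, _, _, h1, rfl⟩ := h
        refine ⟨1, ?_⟩
        obtain ⟨m', rfl⟩ : ∃ m', m = m' + 1 := ⟨m - 1, by omega⟩
        obtain rfl : I = p + m' := by omega
        ring
      · obtain ⟨rfl, _, rfl, rfl⟩ := h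
        exact ⟨0, by ring⟩
      · obtain ⟨rfl, _, rfl, rfl⟩ := h
        exact ⟨1, by ring⟩
      · obtain ⟨_, _, rfl, rfl⟩ := h
        exact ⟨0, by ring⟩
      · obtain ⟨_, _, h1, rfl⟩ := h
        refine ⟨1, ?_⟩
        obtain ⟨m', rfl⟩ : ∃ m', m = m' + 2 := ⟨m - 2, by omega⟩
        obtain rfl : I = p + m' := by omega
        ring
      · obtain ⟨rfl, _, rfl, rfl⟩ := h
        exact ⟨0, by ring⟩
      · obtain ⟨rfl, _, h1, rfl⟩ := h
        refine ⟨1, ?_⟩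
        obtain ⟨m', rfl⟩ : ∃ m', u = m' + 1 := ⟨u - 1, by omega⟩
        obtain rfl : I = p + m' := by omega
        ring
    obtain ⟨z, hz⟩ := e
    rw [hz, Nat.add_mul_mod_self_left, Nat.mod_eq_of_lt hlt]
  rw [g1, key, f1, Nat.mul_comm p, Nat.mul_add_div (by omega), Nat.div_eq_of_lt hu,
    Nat.mul_add_mod, Nat.mod_eq_of_lt hu, Nat.add_zero]

theorem ss1 (m I J I' J' : ℕ) (hm : 4 ≤ m) (h : R1 m I J) (h' : R1 m I' J')
    (H : ∀ p u p' u' c, row1 m I J p u → row1 m I' J' p' u' →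
      colS m p u c → colS m p' u' c → False) : g1 m false I J ≠ g1 m false I' J' := by
  obtain ⟨p, u, h1, h2⟩ := row1_exists m I J hm h
  obtain ⟨p', u', h1', h2'⟩ := row1_exists m I' J' hm h'
  intro heq
  rw [g1_eq m I J p u _ hm h1 h2, g1_eq m I' J' p' u' _ hm h1' h2'] at heq
  refine H p u p' u' _ h1 h1' (colS_spec m p u hm h2) ?_
  rw [heq]
  exact colS_spec m p' u' hm h2'

theorem sb1 (m I J I' J' : ℕ) (hm : 4 ≤ m) (h : R1 m I J) (h' : R1 m I' J')
    (H : ∀ p u p' u' c, row1 m I J p u → row1 m I' J' p' u' →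
      colS m p u c → colB m p' u' c → False) : g1 m false I J ≠ g1 m true I' J' := by
  obtain ⟨p, u, h1, h2⟩ := row1_exists m I J hm h
  obtain ⟨p', u', h1', h2'⟩ := row1_exists m I' J' hm h'
  intro heq
  rw [g1_eq m I J p u _ hm h1 h2, g1_eq m I' J' p' u' _ hm h1' h2'] at heq
  refine H p u p' u' _ h1 h1' (colS_spec m p u hm h2) ?_
  rw [heq]
  exact colB_spec m p' u' hm h2'

theorem bb1 (m I J I' J' : ℕ) (hm : 4 ≤ m) (h : R1 m I J) (h' : R1 m I' J')
    (H : ∀ p u p' u' c, row1 m I J p u → row1 m I' J' p' u' →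
      colB m p u c → colB m p' u' c → False) : g1 m true I J ≠ g1 m true I' J' := by
  obtain ⟨p, u, h1, h2⟩ := row1_exists m I J hm h
  obtain ⟨p', u', h1', h2'⟩ := row1_exists m I' J' hm h'
  intro heq
  rw [g1_eq m I J p u _ hm h1 h2, g1_eq m I' J' p' u' _ hm h1' h2'] at heq
  refine H p u p' u' _ h1 h1' (colB_spec m p u hm h2) ?_
  rw [heq]
  exact colB_spec m p' u' hm h2'

set_option maxHeartbeats 4000000 in
/-- Words `B^q`. -/
theorem bsa1 (m i j q : ℕ) (hm : 4 ≤ m) (hc : can1 m i j) (hq : q + 1 ≤ m) :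
    (cl (f1 m) (m ^ 2) (m + 1) (i * (m + 1) + j) (word5 0 q 0 0 0)).Nodup := by
  unfold can1 at hc
  refine word5_nodup (f1 m) (m ^ 2) (m + 1) i j 0 q 0 0 0 (g1 m) (R1 m)
    (fun b I J _ => rfl) ?_ ?_ ?_ ?_ ?_ ?_ ?_ ?_ ?_ ?_ ?_ ?_ ?_ ?_ ?_ ?_ ?_ ?_ ?_ ?_
  iterate 5 (· intro t ht; unfold R1; omega)
  all_goals intro s t hs ht
  all_goals first
    | (exfalso; omega)
    | refine ss1 m _ _ _ _ hm (by unfold R1; omega) (by unfold R1; omega) ?_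
    | refine bb1 m _ _ _ _ hm (by unfold R1; omega) (by unfold R1; omega) ?_
    | refine sb1 m _ _ _ _ hm (by unfold R1; omega) (by unfold R1; omega) ?_
    | refine (sb1 m _ _ _ _ hm (by unfold R1; omega) (by unfold R1; omega) ?_).symm
  all_goals
    intro p u p' u' c h1 h2 h3 h4
    unfold row1 at h1 h2
    (try unfold colS at h3)
    (try unfold colS at h4)
    (try unfold colB at h3)
    (try unfold colB at h4)
    rcases h1 with h1 | h1 | h1 | h1 | h1 | h1 | h1 | h1 <;> first
      | (clear h2 h3 h4; omega)
      | (rcases h2 with h2 | h2 | h2 | h2 | h2 | h2 | h2 | h2 <;> first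
          | (clear h3 h4; omega)
          | (rcases h3 with h3 | h3 | h3 | h3 | h3 <;> first
              | (clear h4; omega)
              | (rcases h4 with h4 | h4 | h4 | h4 | h4 <;> omega)))


set_option maxHeartbeats 4000000 in
/-- Words `S^r` from the exceptional vertex. -/
theorem bsb1 (m i r : ℕ) (hm : 4 ≤ m) (hi : i + 1 = m) (hr : r ≤ m) :
    (cl (f1 m) (m ^ 2) (m + 1) (i * (m + 1) + 0) (word5 0 0 r 0 0)).Nodup := by
  refine word5_nodup (f1 m) (m ^ 2) (m + 1) i 0 0 0 r 0 0 (g1 m) (R1 m)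
    (fun b I J _ => rfl) ?_ ?_ ?_ ?_ ?_ ?_ ?_ ?_ ?_ ?_ ?_ ?_ ?_ ?_ ?_ ?_ ?_ ?_ ?_ ?_
  iterate 5 (· intro t ht; unfold R1; omega)
  all_goals intro s t hs ht
  all_goals first
    | (exfalso; omega)
    | refine ss1 m _ _ _ _ hm (by unfold R1; omega) (by unfold R1; omega) ?_
    | refine bb1 m _ _ _ _ hm (by unfold R1; omega) (by unfold R1; omega) ?_
    | refine sb1 m _ _ _ _ hm (by unfold R1; omega) (by unfold R1; omega) ?_
    | refine (sb1 m _ _ _ _ hm (by unfold R1; omega) (by unfold R1; omega) ?_).symm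
  all_goals
    intro p u p' u' c h1 h2 h3 h4
    unfold row1 at h1 h2
    (try unfold colS at h3)
    (try unfold colS at h4)
    (try unfold colB at h3)
    (try unfold colB at h4)
    rcases h1 with h1 | h1 | h1 | h1 | h1 | h1 | h1 | h1 <;> first
      | (clear h2 h3 h4; omega)
      | (rcases h2 with h2 | h2 | h2 | h2 | h2 | h2 | h2 | h2 <;> first
          | (clear h3 h4; omega)
          | (rcases h3 with h3 | h3 | h3 | h3 | h3 <;> first
              | (clear h4; omega)
              | (rcases h4 with h4 | h4 | h4 | h4 | h4 <;> omega)))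


set_option maxHeartbeats 4000000 in
/-- Words `B^q S^r` from column zero. -/
theorem bsc1 (m i q r : ℕ) (hm : 4 ≤ m) (hi : i + 1 < m) (hr : 1 ≤ r) (hr' : r ≤ m)
    (hq : i + q + 1 ≤ m) (hq' : q + 2 ≤ m) (hn : 1 ≤ i ∨ 1 ≤ q ∨ r < m) :
    (cl (f1 m) (m ^ 2) (m + 1) (i * (m + 1) + 0) (word5 0 q r 0 0)).Nodup := by
  refine word5_nodup (f1 m) (m ^ 2) (m + 1) i 0 0 q r 0 0 (g1 m) (R1 m)
    (fun b I J _ => rfl) ?_ ?_ ?_ ?_ ?_ ?_ ?_ ?_ ?_ ?_ ?_ ?_ ?_ ?_ ?_ ?_ ?_ ?_ ?_ ?_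
  iterate 5 (· intro t ht; unfold R1; omega)
  all_goals intro s t hs ht
  all_goals first
    | (exfalso; omega)
    | refine ss1 m _ _ _ _ hm (by unfold R1; omega) (by unfold R1; omega) ?_
    | refine bb1 m _ _ _ _ hm (by unfold R1; omega) (by unfold R1; omega) ?_
    | refine sb1 m _ _ _ _ hm (by unfold R1; omega) (by unfold R1; omega) ?_
    | refine (sb1 m _ _ _ _ hm (by unfold R1; omega) (by unfold R1; omega) ?_).symm
  all_goals
    intro p u p' u' c h1 h2 h3 h4
    unfold row1 at h1 h2
    (try unfold colS at h3)
    (try unfold colS at h4)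
    (try unfold colB at h3)
    (try unfold colB at h4)
    rcases h1 with h1 | h1 | h1 | h1 | h1 | h1 | h1 | h1 <;> first
      | (clear h2 h3 h4; omega)
      | (rcases h2 with h2 | h2 | h2 | h2 | h2 | h2 | h2 | h2 <;> first
          | (clear h3 h4; omega)
          | (rcases h3 with h3 | h3 | h3 | h3 | h3 <;> first
              | (clear h4; omega)
              | (rcases h4 with h4 | h4 | h4 | h4 | h4 <;> omega)))


set_option maxHeartbeats 4000000 in
/-- Words `B^q S^r`, generic case. -/
theorem bsd1 (m i j q r : ℕ) (hm : 4 ≤ m) (hi : i + 1 < m) (hj : 1 ≤ j) (hj' : j ≤ m) (hr : 1 ≤ r)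
    (hr' : r ≤ m) (hq : q + 2 ≤ m) (hn : 1 ≤ i ∨ q + 2 < m ∨ j + r < m + 3)
    (hn' : i = 0 ∨ 2 ≤ j ∨ q + i + 1 < m ∨ m ≤ q + i ∨ r < m)
    (hn2 : i ≤ 1 ∨ q + 2 < m ∨ i + j + r < 2 * m + 2) :
    (cl (f1 m) (m ^ 2) (m + 1) (i * (m + 1) + j) (word5 0 q r 0 0)).Nodup := by
  refine word5_nodup (f1 m) (m ^ 2) (m + 1) i j 0 q r 0 0 (g1 m) (R1 m)
    (fun b I J _ => rfl) ?_ ?_ ?_ ?_ ?_ ?_ ?_ ?_ ?_ ?_ ?_ ?_ ?_ ?_ ?_ ?_ ?_ ?_ ?_ ?_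
  iterate 5 (· intro t ht; unfold R1; omega)
  all_goals intro s t hs ht
  all_goals first
    | (exfalso; omega)
    | refine ss1 m _ _ _ _ hm (by unfold R1; omega) (by unfold R1; omega) ?_
    | refine bb1 m _ _ _ _ hm (by unfold R1; omega) (by unfold R1; omega) ?_
    | refine sb1 m _ _ _ _ hm (by unfold R1; omega) (by unfold R1; omega) ?_
    | refine (sb1 m _ _ _ _ hm (by unfold R1; omega) (by unfold R1; omega) ?_).symm
  all_goals
    intro p u p' u' c h1 h2 h3 h4
    unfold row1 at h1 h2
    (try unfold colS at h3)
    (try unfold colS at h4)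
    (try unfold colB at h3)
    (try unfold colB at h4)
    rcases h1 with h1 | h1 | h1 | h1 | h1 | h1 | h1 | h1 <;> first
      | (clear h2 h3 h4; omega)
      | (rcases h2 with h2 | h2 | h2 | h2 | h2 | h2 | h2 | h2 <;> first
          | (clear h3 h4; omega)
          | (rcases h3 with h3 | h3 | h3 | h3 | h3 <;> first
              | (clear h4; omega)
              | (rcases h4 with h4 | h4 | h4 | h4 | h4 <;> omega)))


set_option maxHeartbeats 4000000 in
/-- Words `S B^q S^x` from the exceptional vertex. -/
theorem sa1 (m i q x : ℕ) (hm : 4 ≤ m) (hi : i + 1 = m) (hq : 1 ≤ q) (hq' : q + 2 ≤ m) (hx : x + 1 ≤ m)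
    (hn : q + 3 ≤ m ∨ x ≤ 1) :
    (cl (f1 m) (m ^ 2) (m + 1) (i * (m + 1) + 0) (word5 1 q x 0 0)).Nodup := by
  refine word5_nodup (f1 m) (m ^ 2) (m + 1) i 0 1 q x 0 0 (g1 m) (R1 m)
    (fun b I J _ => rfl) ?_ ?_ ?_ ?_ ?_ ?_ ?_ ?_ ?_ ?_ ?_ ?_ ?_ ?_ ?_ ?_ ?_ ?_ ?_ ?_
  iterate 5 (· intro t ht; unfold R1; omega)
  all_goals intro s t hs ht
  all_goals first
    | (exfalso; omega)
    | refine ss1 m _ _ _ _ hm (by unfold R1; omega) (by unfold R1; omega) ?_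
    | refine bb1 m _ _ _ _ hm (by unfold R1; omega) (by unfold R1; omega) ?_
    | refine sb1 m _ _ _ _ hm (by unfold R1; omega) (by unfold R1; omega) ?_
    | refine (sb1 m _ _ _ _ hm (by unfold R1; omega) (by unfold R1; omega) ?_).symm
  all_goals
    intro p u p' u' c h1 h2 h3 h4
    unfold row1 at h1 h2
    (try unfold colS at h3)
    (try unfold colS at h4)
    (try unfold colB at h3)
    (try unfold colB at h4)
    rcases h1 with h1 | h1 | h1 | h1 | h1 | h1 | h1 | h1 <;> first
      | (clear h2 h3 h4; omega)
      | (rcases h2 with h2 | h2 | h2 | h2 | h2 | h2 | h2 | h2 <;> first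
          | (clear h3 h4; omega)
          | (rcases h3 with h3 | h3 | h3 | h3 | h3 <;> first
              | (clear h4; omega)
              | (rcases h4 with h4 | h4 | h4 | h4 | h4 <;> omega)))


set_option maxHeartbeats 4000000 in
/-- Words `S B^q S^x` from column zero. -/
theorem sb1w (m i q x : ℕ) (hm : 4 ≤ m) (hi : i + 1 < m) (hq : q + 2 ≤ m) (hx : x + 1 ≤ m)
    (hn : m + 1 ≤ i + q) (hn' : q + x + 1 ≤ m) :
    (cl (f1 m) (m ^ 2) (m + 1) (i * (m + 1) + 0) (word5 1 q x 0 0)).Nodup := by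
  refine word5_nodup (f1 m) (m ^ 2) (m + 1) i 0 1 q x 0 0 (g1 m) (R1 m)
    (fun b I J _ => rfl) ?_ ?_ ?_ ?_ ?_ ?_ ?_ ?_ ?_ ?_ ?_ ?_ ?_ ?_ ?_ ?_ ?_ ?_ ?_ ?_
  iterate 5 (· intro t ht; unfold R1; omega)
  all_goals intro s t hs ht
  all_goals first
    | (exfalso; omega)
    | refine ss1 m _ _ _ _ hm (by unfold R1; omega) (by unfold R1; omega) ?_
    | refine bb1 m _ _ _ _ hm (by unfold R1; omega) (by unfold R1; omega) ?_
    | refine sb1 m _ _ _ _ hm (by unfold R1; omega) (by unfold R1; omega) ?_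
    | refine (sb1 m _ _ _ _ hm (by unfold R1; omega) (by unfold R1; omega) ?_).symm
  all_goals
    intro p u p' u' c h1 h2 h3 h4
    unfold row1 at h1 h2
    (try unfold colS at h3)
    (try unfold colS at h4)
    (try unfold colB at h3)
    (try unfold colB at h4)
    rcases h1 with h1 | h1 | h1 | h1 | h1 | h1 | h1 | h1 <;> first
      | (clear h2 h3 h4; omega)
      | (rcases h2 with h2 | h2 | h2 | h2 | h2 | h2 | h2 | h2 <;> first
          | (clear h3 h4; omega)
          | (rcases h3 with h3 | h3 | h3 | h3 | h3 <;> first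
              | (clear h4; omega)
              | (rcases h4 with h4 | h4 | h4 | h4 | h4 <;> omega)))


set_option maxHeartbeats 4000000 in
/-- Words `S B^y S^x B S^z` from the exceptional vertex. -/
theorem ta1 (m i y x z : ℕ) (hm : 4 ≤ m) (hi : i + 1 = m) (hy : y + 3 = m) (hx : x = 2) (hz : z + 3 ≤ m) :
    (cl (f1 m) (m ^ 2) (m + 1) (i * (m + 1) + 0) (word5 1 y x 1 z)).Nodup := by
  refine word5_nodup (f1 m) (m ^ 2) (m + 1) i 0 1 y x 1 z (g1 m) (R1 m)
    (fun b I J _ => rfl) ?_ ?_ ?_ ?_ ?_ ?_ ?_ ?_ ?_ ?_ ?_ ?_ ?_ ?_ ?_ ?_ ?_ ?_ ?_ ?_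
  iterate 5 (· intro t ht; unfold R1; omega)
  all_goals intro s t hs ht
  all_goals first
    | (exfalso; omega)
    | refine ss1 m _ _ _ _ hm (by unfold R1; omega) (by unfold R1; omega) ?_
    | refine bb1 m _ _ _ _ hm (by unfold R1; omega) (by unfold R1; omega) ?_
    | refine sb1 m _ _ _ _ hm (by unfold R1; omega) (by unfold R1; omega) ?_
    | refine (sb1 m _ _ _ _ hm (by unfold R1; omega) (by unfold R1; omega) ?_).symm
  all_goals
    intro p u p' u' c h1 h2 h3 h4
    unfold row1 at h1 h2
    (try unfold colS at h3)
    (try unfold colS at h4)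
    (try unfold colB at h3)
    (try unfold colB at h4)
    rcases h1 with h1 | h1 | h1 | h1 | h1 | h1 | h1 | h1 <;> first
      | (clear h2 h3 h4; omega)
      | (rcases h2 with h2 | h2 | h2 | h2 | h2 | h2 | h2 | h2 <;> first
          | (clear h3 h4; omega)
          | (rcases h3 with h3 | h3 | h3 | h3 | h3 <;> first
              | (clear h4; omega)
              | (rcases h4 with h4 | h4 | h4 | h4 | h4 <;> omega)))


set_option maxHeartbeats 4000000 in
/-- Words `S B^y S^x B S^z` from column zero. -/
theorem tb1 (m i y x z : ℕ) (hm : 4 ≤ m) (hi : i + 1 < m) (hx : x + y + 1 = m) (hy : y + 3 ≤ m)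
    (hz : z + 1 + x ≤ m) (hn : m ≤ i + y) :
    (cl (f1 m) (m ^ 2) (m + 1) (i * (m + 1) + 0) (word5 1 y x 1 z)).Nodup := by
  refine word5_nodup (f1 m) (m ^ 2) (m + 1) i 0 1 y x 1 z (g1 m) (R1 m)
    (fun b I J _ => rfl) ?_ ?_ ?_ ?_ ?_ ?_ ?_ ?_ ?_ ?_ ?_ ?_ ?_ ?_ ?_ ?_ ?_ ?_ ?_ ?_
  iterate 5 (· intro t ht; unfold R1; omega)
  all_goals intro s t hs ht
  all_goals first
    | (exfalso; omega)
    | refine ss1 m _ _ _ _ hm (by unfold R1; omega) (by unfold R1; omega) ?_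
    | refine bb1 m _ _ _ _ hm (by unfold R1; omega) (by unfold R1; omega) ?_
    | refine sb1 m _ _ _ _ hm (by unfold R1; omega) (by unfold R1; omega) ?_
    | refine (sb1 m _ _ _ _ hm (by unfold R1; omega) (by unfold R1; omega) ?_).symm
  all_goals
    intro p u p' u' c h1 h2 h3 h4
    unfold row1 at h1 h2
    (try unfold colS at h3)
    (try unfold colS at h4)
    (try unfold colB at h3)
    (try unfold colB at h4)
    rcases h1 with h1 | h1 | h1 | h1 | h1 | h1 | h1 | h1 <;> first
      | (clear h2 h3 h4; omega)
      | (rcases h2 with h2 | h2 | h2 | h2 | h2 | h2 | h2 | h2 <;> first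
          | (clear h3 h4; omega)
          | (rcases h3 with h3 | h3 | h3 | h3 | h3 <;> first
              | (clear h4; omega)
              | (rcases h4 with h4 | h4 | h4 | h4 | h4 <;> omega)))


set_option maxHeartbeats 4000000 in
/-- Words `S B^y S^x B S^z` from column one. -/
theorem tc1 (m i y x z : ℕ) (hm : 4 ≤ m) (hi : 1 ≤ i) (hi' : i + 2 < m) (hy : y + 2 + i = m)
    (hx : x + y + 1 = m) (hz : z = y) :
    (cl (f1 m) (m ^ 2) (m + 1) (i * (m + 1) + 1) (word5 1 y x 1 z)).Nodup := by
  refine word5_nodup (f1 m) (m ^ 2) (m + 1) i 1 1 y x 1 z (g1 m) (R1 m)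
    (fun b I J _ => rfl) ?_ ?_ ?_ ?_ ?_ ?_ ?_ ?_ ?_ ?_ ?_ ?_ ?_ ?_ ?_ ?_ ?_ ?_ ?_ ?_
  iterate 5 (· intro t ht; unfold R1; omega)
  all_goals intro s t hs ht
  all_goals first
    | (exfalso; omega)
    | refine ss1 m _ _ _ _ hm (by unfold R1; omega) (by unfold R1; omega) ?_
    | refine bb1 m _ _ _ _ hm (by unfold R1; omega) (by unfold R1; omega) ?_
    | refine sb1 m _ _ _ _ hm (by unfold R1; omega) (by unfold R1; omega) ?_
    | refine (sb1 m _ _ _ _ hm (by unfold R1; omega) (by unfold R1; omega) ?_).symm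
  all_goals
    intro p u p' u' c h1 h2 h3 h4
    unfold row1 at h1 h2
    (try unfold colS at h3)
    (try unfold colS at h4)
    (try unfold colB at h3)
    (try unfold colB at h4)
    rcases h1 with h1 | h1 | h1 | h1 | h1 | h1 | h1 | h1 <;> first
      | (clear h2 h3 h4; omega)
      | (rcases h2 with h2 | h2 | h2 | h2 | h2 | h2 | h2 | h2 <;> first
          | (clear h3 h4; omega)
          | (rcases h3 with h3 | h3 | h3 | h3 | h3 <;> first
              | (clear h4; omega)
              | (rcases h4 with h4 | h4 | h4 | h4 | h4 <;> omega)))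


set_option maxHeartbeats 4000000 in
/-- Words `B^y S B S^z`. -/
theorem u1 (m i y z : ℕ) (hm : 4 ≤ m) (hi : i + 1 < m) (hi' : 2 ≤ i) (hy : y + i + 1 = m) (hz : z + 1 ≤ m) :
    (cl (f1 m) (m ^ 2) (m + 1) (i * (m + 1) + 0) (word5 0 y 1 1 z)).Nodup := by
  refine word5_nodup (f1 m) (m ^ 2) (m + 1) i 0 0 y 1 1 z (g1 m) (R1 m)
    (fun b I J _ => rfl) ?_ ?_ ?_ ?_ ?_ ?_ ?_ ?_ ?_ ?_ ?_ ?_ ?_ ?_ ?_ ?_ ?_ ?_ ?_ ?_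
  iterate 5 (· intro t ht; unfold R1; omega)
  all_goals intro s t hs ht
  all_goals first
    | (exfalso; omega)
    | refine ss1 m _ _ _ _ hm (by unfold R1; omega) (by unfold R1; omega) ?_
    | refine bb1 m _ _ _ _ hm (by unfold R1; omega) (by unfold R1; omega) ?_
    | refine sb1 m _ _ _ _ hm (by unfold R1; omega) (by unfold R1; omega) ?_
    | refine (sb1 m _ _ _ _ hm (by unfold R1; omega) (by unfold R1; omega) ?_).symm
  all_goals
    intro p u p' u' c h1 h2 h3 h4
    unfold row1 at h1 h2
    (try unfold colS at h3)
    (try unfold colS at h4)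
    (try unfold colB at h3)
    (try unfold colB at h4)
    rcases h1 with h1 | h1 | h1 | h1 | h1 | h1 | h1 | h1 <;> first
      | (clear h2 h3 h4; omega)
      | (rcases h2 with h2 | h2 | h2 | h2 | h2 | h2 | h2 | h2 <;> first
          | (clear h3 h4; omega)
          | (rcases h3 with h3 | h3 | h3 | h3 | h3 <;> first
              | (clear h4; omega)
              | (rcases h4 with h4 | h4 | h4 | h4 | h4 <;> omega)))


set_option maxHeartbeats 4000000 in
/-- Words `S B^y S B S^z`. -/
theorem v1 (m i y z : ℕ) (hm : 4 ≤ m) (hi : i = 0) (hy : y + 3 = m) (hz : z + 2 = m) :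
    (cl (f1 m) (m ^ 2) (m + 1) (i * (m + 1) + m) (word5 1 y 1 1 z)).Nodup := by
  refine word5_nodup (f1 m) (m ^ 2) (m + 1) i m 1 y 1 1 z (g1 m) (R1 m)
    (fun b I J _ => rfl) ?_ ?_ ?_ ?_ ?_ ?_ ?_ ?_ ?_ ?_ ?_ ?_ ?_ ?_ ?_ ?_ ?_ ?_ ?_ ?_
  iterate 5 (· intro t ht; unfold R1; omega)
  all_goals intro s t hs ht
  all_goals first
    | (exfalso; omega)
    | refine ss1 m _ _ _ _ hm (by unfold R1; omega) (by unfold R1; omega) ?_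
    | refine bb1 m _ _ _ _ hm (by unfold R1; omega) (by unfold R1; omega) ?_
    | refine sb1 m _ _ _ _ hm (by unfold R1; omega) (by unfold R1; omega) ?_
    | refine (sb1 m _ _ _ _ hm (by unfold R1; omega) (by unfold R1; omega) ?_).symm
  all_goals
    intro p u p' u' c h1 h2 h3 h4
    unfold row1 at h1 h2
    (try unfold colS at h3)
    (try unfold colS at h4)
    (try unfold colB at h3)
    (try unfold colB at h4)
    rcases h1 with h1 | h1 | h1 | h1 | h1 | h1 | h1 | h1 <;> first
      | (clear h2 h3 h4; omega)
      | (rcases h2 with h2 | h2 | h2 | h2 | h2 | h2 | h2 | h2 <;> first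
          | (clear h3 h4; omega)
          | (rcases h3 with h3 | h3 | h3 | h3 | h3 <;> first
              | (clear h4; omega)
              | (rcases h4 with h4 | h4 | h4 | h4 | h4 <;> omega)))


set_option maxHeartbeats 4000000 in
/-- Words `S^r B^q`. -/
theorem v2 (m i j r q : ℕ) (hm : 4 ≤ m) (hi : i = 0) (hj : j ≤ m) (hr : r ≤ m) (hq : q + 2 = m)
    (hn : m + 3 ≤ j + r) (hn' : j + r < 2 * m) :
    (cl (f1 m) (m ^ 2) (m + 1) (i * (m + 1) + j) (word5 r q 0 0 0)).Nodup := by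
  refine word5_nodup (f1 m) (m ^ 2) (m + 1) i j r q 0 0 0 (g1 m) (R1 m)
    (fun b I J _ => rfl) ?_ ?_ ?_ ?_ ?_ ?_ ?_ ?_ ?_ ?_ ?_ ?_ ?_ ?_ ?_ ?_ ?_ ?_ ?_ ?_
  iterate 5 (· intro t ht; unfold R1; omega)
  all_goals intro s t hs ht
  all_goals first
    | (exfalso; omega)
    | refine ss1 m _ _ _ _ hm (by unfold R1; omega) (by unfold R1; omega) ?_
    | refine bb1 m _ _ _ _ hm (by unfold R1; omega) (by unfold R1; omega) ?_
    | refine sb1 m _ _ _ _ hm (by unfold R1; omega) (by unfold R1; omega) ?_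
    | refine (sb1 m _ _ _ _ hm (by unfold R1; omega) (by unfold R1; omega) ?_).symm
  all_goals
    intro p u p' u' c h1 h2 h3 h4
    unfold row1 at h1 h2
    (try unfold colS at h3)
    (try unfold colS at h4)
    (try unfold colB at h3)
    (try unfold colB at h4)
    rcases h1 with h1 | h1 | h1 | h1 | h1 | h1 | h1 | h1 <;> first
      | (clear h2 h3 h4; omega)
      | (rcases h2 with h2 | h2 | h2 | h2 | h2 | h2 | h2 | h2 <;> first
          | (clear h3 h4; omega)
          | (rcases h3 with h3 | h3 | h3 | h3 | h3 <;> first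
              | (clear h4; omega)
              | (rcases h4 with h4 | h4 | h4 | h4 | h4 <;> omega)))


set_option maxHeartbeats 4000000 in
/-- Words `B^y S^r B^z`. -/
theorem w1 (m i j y r z : ℕ) (hm : 4 ≤ m) (hi : 2 ≤ i) (hi' : i + 1 < m) (hj : 1 ≤ j) (hj' : j ≤ m) (hr : r ≤ m)
    (hy : y + i + 1 = m) (hz : z + 1 = i) (hn : 2 * m + 2 ≤ i + j + r) :
    (cl (f1 m) (m ^ 2) (m + 1) (i * (m + 1) + j) (word5 0 y r z 0)).Nodup := by
  refine word5_nodup (f1 m) (m ^ 2) (m + 1) i j 0 y r z 0 (g1 m) (R1 m)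
    (fun b I J _ => rfl) ?_ ?_ ?_ ?_ ?_ ?_ ?_ ?_ ?_ ?_ ?_ ?_ ?_ ?_ ?_ ?_ ?_ ?_ ?_ ?_
  iterate 5 (· intro t ht; unfold R1; omega)
  all_goals intro s t hs ht
  all_goals first
    | (exfalso; omega)
    | refine ss1 m _ _ _ _ hm (by unfold R1; omega) (by unfold R1; omega) ?_
    | refine bb1 m _ _ _ _ hm (by unfold R1; omega) (by unfold R1; omega) ?_
    | refine sb1 m _ _ _ _ hm (by unfold R1; omega) (by unfold R1; omega) ?_
    | refine (sb1 m _ _ _ _ hm (by unfold R1; omega) (by unfold R1; omega) ?_).symm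
  all_goals
    intro p u p' u' c h1 h2 h3 h4
    unfold row1 at h1 h2
    (try unfold colS at h3)
    (try unfold colS at h4)
    (try unfold colB at h3)
    (try unfold colB at h4)
    rcases h1 with h1 | h1 | h1 | h1 | h1 | h1 | h1 | h1 <;> first
      | (clear h2 h3 h4; omega)
      | (rcases h2 with h2 | h2 | h2 | h2 | h2 | h2 | h2 | h2 <;> first
          | (clear h3 h4; omega)
          | (rcases h3 with h3 | h3 | h3 | h3 | h3 <;> first
              | (clear h4; omega)
              | (rcases h4 with h4 | h4 | h4 | h4 | h4 <;> omega)))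


set_option maxHeartbeats 4000000 in
/-- Words `B^m`. -/
theorem ab1 (m i y : ℕ) (hm : 4 ≤ m) (hi : i = 0) (hy : y = m) :
    (cl (f1 m) (m ^ 2) (m + 1) (i * (m + 1) + 0) (word5 0 y 0 0 0)).Nodup := by
  refine word5_nodup (f1 m) (m ^ 2) (m + 1) i 0 0 y 0 0 0 (g1 m) (R1 m)
    (fun b I J _ => rfl) ?_ ?_ ?_ ?_ ?_ ?_ ?_ ?_ ?_ ?_ ?_ ?_ ?_ ?_ ?_ ?_ ?_ ?_ ?_ ?_
  iterate 5 (· intro t ht; unfold R1; omega)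
  all_goals intro s t hs ht
  all_goals first
    | (exfalso; omega)
    | refine ss1 m _ _ _ _ hm (by unfold R1; omega) (by unfold R1; omega) ?_
    | refine bb1 m _ _ _ _ hm (by unfold R1; omega) (by unfold R1; omega) ?_
    | refine sb1 m _ _ _ _ hm (by unfold R1; omega) (by unfold R1; omega) ?_
    | refine (sb1 m _ _ _ _ hm (by unfold R1; omega) (by unfold R1; omega) ?_).symm
  all_goals
    intro p u p' u' c h1 h2 h3 h4
    unfold row1 at h1 h2
    (try unfold colS at h3)
    (try unfold colS at h4)
    (try unfold colB at h3)
    (try unfold colB at h4)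
    rcases h1 with h1 | h1 | h1 | h1 | h1 | h1 | h1 | h1 <;> first
      | (clear h2 h3 h4; omega)
      | (rcases h2 with h2 | h2 | h2 | h2 | h2 | h2 | h2 | h2 <;> first
          | (clear h3 h4; omega)
          | (rcases h3 with h3 | h3 | h3 | h3 | h3 <;> first
              | (clear h4; omega)
              | (rcases h4 with h4 | h4 | h4 | h4 | h4 <;> omega)))


set_option maxHeartbeats 4000000 in
/-- Words `B^(m+1)`. -/
theorem ab2 (m i y : ℕ) (hm : 4 ≤ m) (hi : i + 2 = m) (hy : y = m + 1) :
    (cl (f1 m) (m ^ 2) (m + 1) (i * (m + 1) + 1) (word5 0 y 0 0 0)).Nodup := by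
  refine word5_nodup (f1 m) (m ^ 2) (m + 1) i 1 0 y 0 0 0 (g1 m) (R1 m)
    (fun b I J _ => rfl) ?_ ?_ ?_ ?_ ?_ ?_ ?_ ?_ ?_ ?_ ?_ ?_ ?_ ?_ ?_ ?_ ?_ ?_ ?_ ?_
  iterate 5 (· intro t ht; unfold R1; omega)
  all_goals intro s t hs ht
  all_goals first
    | (exfalso; omega)
    | refine ss1 m _ _ _ _ hm (by unfold R1; omega) (by unfold R1; omega) ?_
    | refine bb1 m _ _ _ _ hm (by unfold R1; omega) (by unfold R1; omega) ?_
    | refine sb1 m _ _ _ _ hm (by unfold R1; omega) (by unfold R1; omega) ?_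
    | refine (sb1 m _ _ _ _ hm (by unfold R1; omega) (by unfold R1; omega) ?_).symm
  all_goals
    intro p u p' u' c h1 h2 h3 h4
    unfold row1 at h1 h2
    (try unfold colS at h3)
    (try unfold colS at h4)
    (try unfold colB at h3)
    (try unfold colB at h4)
    rcases h1 with h1 | h1 | h1 | h1 | h1 | h1 | h1 | h1 <;> first
      | (clear h2 h3 h4; omega)
      | (rcases h2 with h2 | h2 | h2 | h2 | h2 | h2 | h2 | h2 <;> first
          | (clear h3 h4; omega)
          | (rcases h3 with h3 | h3 | h3 | h3 | h3 <;> first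
              | (clear h4; omega)
              | (rcases h4 with h4 | h4 | h4 | h4 | h4 <;> omega)))


theorem case1_word (m i j q r : ℕ) (hm : 4 ≤ m) (hv : can1 m i j) (hd : can1 m q r) :
    ∃ x0 y1 x1 y2 x2, x0 + y1 + x1 + y2 + x2 = q + r ∧
      (y1 + y2 = q ∨ (q = 0 ∧ y1 = m ∧ y2 = 0 ∧ x0 + x1 + x2 = 0 ∧ r = m) ∨
        (q = 1 ∧ y1 = m + 1 ∧ y2 = 0 ∧ x0 + x1 + x2 = 0 ∧ r = m)) ∧
      (cl (f1 m) (m ^ 2) (m + 1) (i * (m + 1) + j) (word5 x0 y1 x1 y2 x2)).Nodup := by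
  have hd' := hd
  have hv' := hv
  unfold can1 at hd' hv'
  by_cases hr : r = 0
  · exact ⟨0, q, 0, 0, 0, by omega, by omega, bsa1 m i j q hm hv (by omega)⟩
  have hq : q + 2 ≤ m := by omega
  have hrm : r ≤ m := by omega
  by_cases hi : i + 1 = m
  · obtain rfl : j = 0 := by omega
    by_cases hq0 : q = 0
    · exact ⟨0, 0, r, 0, 0, by omega, by omega, bsb1 m i r hm hi hrm⟩
    by_cases hc : q + 3 ≤ m ∨ r ≤ 2
    · exact ⟨1, q, r - 1, 0, 0, by omega, by omega,
        sa1 m i q (r - 1) hm hi (by omega) hq (by omega) (by omega)⟩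
    · exact ⟨1, q - 1, m - q, 1, r - 1 - (m - q), by omega, by omega,
        ta1 m i (q - 1) (m - q) (r - 1 - (m - q)) hm hi (by omega) (by omega) (by omega)⟩
  have hi1 : i + 1 < m := by omega
  have hjm : j ≤ m := by omega
  by_cases hj : j = 0
  · subst hj
    by_cases hs : i = 0 ∧ q = 0 ∧ r = m
    · exact ⟨0, m, 0, 0, 0, by omega, by omega, ab1 m i m hm hs.1 rfl⟩
    by_cases h1 : i + q + 1 ≤ m
    · exact ⟨0, q, r, 0, 0, by omega, by omega,
        bsc1 m i q r hm hi1 (by omega) hrm h1 hq (by omega)⟩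
    by_cases h2 : i + q = m
    · exact ⟨0, m - 1 - i, 1, 1, r - 1, by omega, by omega,
        u1 m i (m - 1 - i) (r - 1) hm hi1 (by omega) (by omega) (by omega)⟩
    by_cases h3 : q + r ≤ m
    · exact ⟨1, q, r - 1, 0, 0, by omega, by omega,
        sb1w m i q (r - 1) hm hi1 hq (by omega) (by omega) (by omega)⟩
    · exact ⟨1, q - 1, m - q, 1, r - 1 - (m - q), by omega, by omega,
        tb1 m i (q - 1) (m - q) (r - 1 - (m - q)) hm hi1 (by omega) (by omega) (by omega)
          (by omega)⟩
  by_cases h1 : i = 0 ∧ q + 2 = m ∧ m + 3 ≤ j + r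
  · by_cases h2 : j = m ∧ r = m
    · rw [h2.1]
      exact ⟨1, m - 3, 1, 1, m - 2, by omega, by omega,
        v1 m i (m - 3) (m - 2) hm h1.1 (by omega) (by omega)⟩
    · exact ⟨r, q, 0, 0, 0, by omega, by omega,
        v2 m i j r q hm h1.1 hjm hrm h1.2.1 h1.2.2 (by omega)⟩
  by_cases h2 : 1 ≤ i ∧ j = 1 ∧ q + i + 1 = m ∧ r = m
  · obtain ⟨h3, rfl, h4, h5⟩ := h2
    by_cases h6 : i + 2 = m
    · exact ⟨0, m + 1, 0, 0, 0, by omega, by omega, ab2 m i (m + 1) hm h6 rfl⟩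
    · exact ⟨1, q - 1, m - q, 1, r - 1 - (m - q), by omega, by omega,
        tc1 m i (q - 1) (m - q) (r - 1 - (m - q)) hm h3 (by omega) (by omega) (by omega)
          (by omega)⟩
  by_cases h3 : 2 ≤ i ∧ q + 2 = m ∧ 2 * m + 2 ≤ i + j + r
  · exact ⟨0, m - 1 - i, r, i - 1, 0, by omega, by omega,
      w1 m i j (m - 1 - i) r (i - 1) hm h3.1 hi1 (by omega) hjm hrm (by omega) (by omega) h3.2.2⟩
  · exact ⟨0, q, r, 0, 0, by omega, by omega,
      bsd1 m i j q r hm hi1 (by omega) hjm (by omega) hrm hq (by omega) (by omega) (by omega)⟩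

theorem can1_of_lt (m v : ℕ) (hm : 2 ≤ m) (hv : v < m ^ 2) :
    can1 m (v / (m + 1)) (v % (m + 1)) := by
  have hr : v % (m + 1) < m + 1 := Nat.mod_lt _ (by omega)
  have ed := Nat.div_add_mod v (m + 1)
  unfold can1
  generalize v / (m + 1) = q at *
  generalize v % (m + 1) = r at *
  by_contra hc
  push Not at hc
  obtain ⟨hc1, hc2⟩ := hc
  rcases Nat.lt_or_ge (q + 1) (m + 1) with h3 | h3
  · have h4 : q + 1 = m := by
      by_contra h5
      have := hc1 (by omega)
      omega
    have h5 : 1 ≤ r := Nat.one_le_iff_ne_zero.2 (hc2 h4)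
    subst h4
    nlinarith
  · have : m ≤ q := by omega
    nlinarith

theorem case1_core (m : ℕ) (hm : 2 ≤ m) (f : Bool → ℕ → ℕ)
    (hf : ∀ b v, v < m ^ 2 → f b v < 2 * m - 2)
    (hup : ∀ v d, v < m ^ 2 → 0 < d → d < m ^ 2 → ∃ w : List Bool,
      ((disp (m + 1) w : ℕ) : ZMod (m ^ 2)) = (d : ℕ) ∧
      w.length = d / (m + 1) + d % (m + 1) ∧ (cl f (m ^ 2) (m + 1) v w).Nodup) :
    srcStar (circulant (m ^ 2) ({1, m + 1} : Set ℕ)) = 2 * m - 2 ∧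
    rcStar (circulant (m ^ 2) ({1, m + 1} : Set ℕ)) = 2 * m - 2 := by
  have hlast : (m - 2) * (m + 1) + m < m ^ 2 := by
    obtain ⟨a, rfl⟩ : ∃ a, m = a + 2 := ⟨m - 2, by omega⟩
    rw [Nat.add_sub_cancel]
    nlinarith
  refine framework (m ^ 2) (m + 1) (2 * m - 2) (by positivity) (by omega)
    (k_ne_one _ _ (by omega) (by nlinarith)) f hf (fun d => d / (m + 1) + d % (m + 1))
    (fun d w hd h => low1 m d w hm hd h) hup ((m - 2) * (m + 1) + m) hlast ?_ (by simp)
  show 2 * m - 2 ≤ ((m - 2) * (m + 1) + m) / (m + 1) + ((m - 2) * (m + 1) + m) % (m + 1)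
  rw [Nat.mul_comm (m - 2), Nat.mul_add_div (by omega), Nat.div_eq_of_lt (by omega), Nat.mul_add_mod,
    Nat.mod_eq_of_lt (by omega)]
  omega

theorem case1_large (m : ℕ) (hm : 4 ≤ m) :
    srcStar (circulant (m ^ 2) ({1, m + 1} : Set ℕ)) = 2 * m - 2 ∧
    rcStar (circulant (m ^ 2) ({1, m + 1} : Set ℕ)) = 2 * m - 2 := by
  refine case1_core m (by omega) (f1 m)
    (fun b v hv => c1_lt m _ _ b hm (can1_of_lt m v (by omega) hv)) ?_
  intro v d hv _ hd
  obtain ⟨x0, y1, x1, y2, x2, h1, h2, h3⟩ := case1_word m _ _ _ _ hm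
    (can1_of_lt m v (by omega) hv) (can1_of_lt m d (by omega) hd)
  have ev : v / (m + 1) * (m + 1) + v % (m + 1) = v := by
    rw [mul_comm]; exact Nat.div_add_mod v (m + 1)
  have ed := Nat.div_add_mod d (m + 1)
  rw [ev] at h3
  refine ⟨word5 x0 y1 x1 y2 x2, ?_, ?_, h3⟩
  · rw [word5_disp, ZMod.natCast_eq_natCast_iff]
    generalize d / (m + 1) = q at *
    generalize d % (m + 1) = r at *
    rcases h2 with h2 | ⟨rfl, rfl, rfl, h4, rfl⟩ | ⟨rfl, rfl, rfl, h4, rfl⟩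
    · have h5 : x0 + x1 + x2 = r := by omega
      rw [h2, h5, ← ed, mul_comm, add_comm]
    · rw [h4, ← ed]
      have e : 0 + (r + 0) * (r + 1) = (r + 1) * 0 + r + r ^ 2 * 1 := by ring
      rw [e]
      unfold Nat.ModEq
      rw [Nat.add_mul_mod_self_left]
    · rw [h4, ← ed]
      have e : 0 + (r + 1 + 0) * (r + 1) = (r + 1) * 1 + r + r ^ 2 * 1 := by ring
      rw [e]
      unfold Nat.ModEq
      rw [Nat.add_mul_mod_self_left]
  · rw [word5_length, h1]

def f1a (b : Bool) (v : ℕ) : ℕ := if b then 0 else if v % 2 = 0 then 1 else 0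

def f1b (b : Bool) (v : ℕ) : ℕ :=
  if b then [2, 1, 2, 3, 0, 0, 3, 0, 1].getD v 0 else [3, 2, 1, 2, 3, 0, 3, 2, 1].getD v 0

/-- All Boolean words of a given length. -/
def words : ℕ → List (List Bool)
  | 0 => [[]]
  | n + 1 => (words n).flatMap fun w => [false :: w, true :: w]

theorem words_length : ∀ (n : ℕ) (w : List Bool), w ∈ words n → w.length = n
  | 0, w, h => by simp [words] at h; simp [h]
  | n + 1, w, h => by
    simp only [words, List.mem_flatMap] at h
    obtain ⟨w', h1, h2⟩ := h
    have := words_length n w' h1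
    simp at h2
    rcases h2 with rfl | rfl <;> simp [this]

theorem small_hup (m : ℕ) (f : Bool → ℕ → ℕ)
    (H : ∀ v < m ^ 2, ∀ d < m ^ 2, ((words (d / (m + 1) + d % (m + 1))).any fun w =>
      decide (disp (m + 1) w % (m ^ 2) = d) && decide ((cl f (m ^ 2) (m + 1) v w).Nodup)) = true) :
    ∀ v d, v < m ^ 2 → 0 < d → d < m ^ 2 → ∃ w : List Bool,
      ((disp (m + 1) w : ℕ) : ZMod (m ^ 2)) = (d : ℕ) ∧
      w.length = d / (m + 1) + d % (m + 1) ∧ (cl f (m ^ 2) (m + 1) v w).Nodup := by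
  intro v d hv _ hd
  have h := H v hv d hd
  rw [List.any_eq_true] at h
  obtain ⟨w, hw, h2⟩ := h
  simp only [Bool.and_eq_true, decide_eq_true_eq] at h2
  refine ⟨w, ?_, words_length _ _ hw, h2.2⟩
  rw [ZMod.natCast_eq_natCast_iff]
  unfold Nat.ModEq
  rw [h2.1, Nat.mod_eq_of_lt hd]

theorem hup_a : ∀ v < 2 ^ 2, ∀ d < 2 ^ 2, ((words (d / (2 + 1) + d % (2 + 1))).any fun w =>
    decide (disp (2 + 1) w % (2 ^ 2) = d) &&
      @decide ((cl f1a (2 ^ 2) (2 + 1) v w).Nodup) (List.nodupDecidable _)) = true := by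
  decide +kernel

theorem hup_b : ∀ v < 3 ^ 2, ∀ d < 3 ^ 2, ((words (d / (3 + 1) + d % (3 + 1))).any fun w =>
    decide (disp (3 + 1) w % (3 ^ 2) = d) &&
      @decide ((cl f1b (3 ^ 2) (3 + 1) v w).Nodup) (List.nodupDecidable _)) = true := by
  decide +kernel

theorem case1 (m : ℕ) (hm : 2 ≤ m) :
    srcStar (circulant (m ^ 2) ({1, m + 1} : Set ℕ)) = 2 * m - 2 ∧
    rcStar (circulant (m ^ 2) ({1, m + 1} : Set ℕ)) = 2 * m - 2 := by
  rcases Nat.lt_or_ge m 4 with h | h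
  · obtain rfl | rfl : m = 2 ∨ m = 3 := by omega
    · refine case1_core 2 hm f1a ?_ (small_hup 2 f1a ?_)
      · intro b v _
        unfold f1a
        split_ifs <;> omega
      · intro v hv d hd
        convert hup_a v hv d hd
    · refine case1_core 3 hm f1b ?_ (small_hup 3 f1b ?_)
      · intro b v hv
        have hv' : v < 9 := by simpa using hv
        cases b <;> interval_cases v <;> decide
      · intro v hv d hd
        convert hup_b v hv d hd
  · exact case1_large m h

/-- For every `k ≥ 3`, `src*(C_{(k-1)²}({1,k})) = rc*(C_{(k-1)²}({1,k})) = 2k - 4`;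
and if `n = a·k` with `a ≥ k - 1 ≥ 2`, then
`src*(C_n({1,k})) = rc*(C_n({1,k})) = a + k - 2`. -/
theorem stmt19 :
    (∀ k : ℕ, 3 ≤ k →
      srcStar (circulant ((k - 1) ^ 2) ({1, k} : Set ℕ)) = 2 * k - 4 ∧
      rcStar (circulant ((k - 1) ^ 2) ({1, k} : Set ℕ)) = 2 * k - 4) ∧
    (∀ a k : ℕ, 2 ≤ k - 1 → k - 1 ≤ a →
      srcStar (circulant (a * k) ({1, k} : Set ℕ)) = a + k - 2 ∧
      rcStar (circulant (a * k) ({1, k} : Set ℕ)) = a + k - 2) := by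
  refine ⟨?_, fun a k h1 h2 => case2 a k (by omega) (by omega)⟩
  intro k hk
  obtain ⟨m, rfl⟩ : ∃ m, k = m + 1 := ⟨k - 1, by omega⟩
  have h := case1 m (by omega)
  rw [Nat.add_sub_cancel, show 2 * (m + 1) - 4 = 2 * m - 2 by omega]
  exact h

end RainbowDigraph
end
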